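/- arXiv:1409.0810 — 7 statements merged into one kernel-verified Lean document; each statement's English description precedes it below -/
import Mathlib

section
/- Let p > 2, N ≥ 1, A ≥ 0 and M > 0. Define d(x) = 1 − |x| and h(x) = A + M(1 − 1/(1 + d(x))) for x in the open unit ball B₁ of ℝᴺ. Then for every x ∈ B₁ with x ≠ 0, h is C² in a neighborhood of x and (p−1) Σᵢ₌₁ᴺ |∂ᵢh(x)|^{p−2} ∂ᵢᵢh(x) ≤ −2^{−2p} M^{p−1} (p−1) N^{1−p/2}. -/
open Metric MeasureTheory Topology Filter Set

/-- The pseudo-p-Laplacian operator (non-divergence form)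
`Σᵢ |∂ᵢφ(x)|^(p-2) ∂ᵢᵢφ(x)` applied to a test function `φ` at `x`. -/
noncomputable def pseudoPOp (p : ℝ) {N : ℕ} (φ : EuclideanSpace ℝ (Fin N) → ℝ)
    (x : EuclideanSpace ℝ (Fin N)) : ℝ :=
  ∑ i : Fin N, |fderiv ℝ φ x (EuclideanSpace.single i 1)| ^ (p - 2) *
    fderiv ℝ (fun y => fderiv ℝ φ y (EuclideanSpace.single i 1)) x (EuclideanSpace.single i 1)

/-- `u` is a viscosity subsolution of `Σᵢ |∂ᵢu|^(p-2) ∂ᵢᵢu = f` on `Ω`: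
for every `x₀ ∈ Ω` and every `φ` which is `C²` in a neighborhood of `x₀` such that
`u - φ` has a local maximum equal to `0` at `x₀`, one has `Σᵢ |∂ᵢφ(x₀)|^(p-2) ∂ᵢᵢφ(x₀) ≥ f(x₀)`. -/
def IsViscSubsol (p : ℝ) {N : ℕ} (Ω : Set (EuclideanSpace ℝ (Fin N)))
    (u f : EuclideanSpace ℝ (Fin N) → ℝ) : Prop :=
  ∀ x₀ ∈ Ω, ∀ φ : EuclideanSpace ℝ (Fin N) → ℝ,
    (∃ ε > 0, ContDiffOn ℝ 2 φ (ball x₀ ε)) →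
    u x₀ = φ x₀ → (∀ᶠ x in 𝓝 x₀, u x ≤ φ x) →
    f x₀ ≤ pseudoPOp p φ x₀

/-- `u` is a viscosity supersolution of `Σᵢ |∂ᵢu|^(p-2) ∂ᵢᵢu = f` on `Ω`. -/
def IsViscSupersol (p : ℝ) {N : ℕ} (Ω : Set (EuclideanSpace ℝ (Fin N)))
    (u f : EuclideanSpace ℝ (Fin N) → ℝ) : Prop :=
  ∀ x₀ ∈ Ω, ∀ φ : EuclideanSpace ℝ (Fin N) → ℝ,
    (∃ ε > 0, ContDiffOn ℝ 2 φ (ball x₀ ε)) →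
    u x₀ = φ x₀ → (∀ᶠ x in 𝓝 x₀, φ x ≤ u x) →
    pseudoPOp p φ x₀ ≤ f x₀

lemma bp_norm {N : ℕ} (y : EuclideanSpace ℝ (Fin N)) (hy : y ≠ 0) :
    HasFDerivAt (fun z : EuclideanSpace ℝ (Fin N) => ‖z‖) ((1 / ‖y‖) • innerSL ℝ y) y := by
  have h1 := ((hasStrictFDerivAt_norm_sq y).hasFDerivAt).sqrt
    (by simpa using hy)
  simp only [Real.sqrt_sq (norm_nonneg _)] at h1
  have hn := norm_ne_zero_iff.2 hy
  have e : (1 / ‖y‖) • innerSL ℝ y = (1 / (2 * ‖y‖)) • 2 • innerSL ℝ y := by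
    ext v
    simp
    field_simp
  rw [e]
  exact h1

lemma bp_first {N : ℕ} (A M : ℝ) (y : EuclideanSpace ℝ (Fin N)) (hy : y ≠ 0) (hy1 : ‖y‖ < 2)
    (i : Fin N) :
    fderiv ℝ (fun x : EuclideanSpace ℝ (Fin N) => A + M * (1 - 1 / (1 + (1 - ‖x‖)))) y
      (EuclideanSpace.single i 1) = y i * (-M / (‖y‖ * (2 - ‖y‖) ^ 2)) := by
  have hn := norm_ne_zero_iff.2 hy
  have h2 : (1 + (1 - ‖y‖)) ≠ 0 := by linarith
  have h2' : (2 - ‖y‖) ≠ 0 := by linarith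
  have hd : HasDerivAt (fun r : ℝ => A + M * (1 - 1 / (1 + (1 - r)))) (-M / (2 - ‖y‖) ^ 2) ‖y‖ := by
    have a := (((((hasDerivAt_id ‖y‖).const_sub 1).const_add 1).fun_inv h2).const_sub 1
      |>.const_mul M).const_add A
    simp only [one_div]
    have e : -M / (2 - ‖y‖) ^ 2 = M * -(- -1 / (1 + (1 - id ‖y‖)) ^ 2) := by
      have : (1 + (1 - id ‖y‖)) = 2 - ‖y‖ := by simp only [id]; ring
      rw [this]; ring
    rw [e]
    exact a
  have := (hd.comp_hasFDerivAt y (bp_norm y hy)).fderiv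
  simp only [Function.comp_def] at this
  rw [this]
  simp [EuclideanSpace.inner_single_right]
  field_simp

lemma bp_second {N : ℕ} (M : ℝ) (y : EuclideanSpace ℝ (Fin N)) (hy : y ≠ 0) (hy1 : ‖y‖ < 2)
    (i : Fin N) :
    fderiv ℝ (fun y : EuclideanSpace ℝ (Fin N) => y i * (-M / (‖y‖ * (2 - ‖y‖) ^ 2))) y
      (EuclideanSpace.single i 1) = -M * (2 * (y i / ‖y‖) ^ 2 / (2 - ‖y‖) ^ 3
        + (1 - (y i / ‖y‖) ^ 2) / (‖y‖ * (2 - ‖y‖) ^ 2)) := by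
  have hn := norm_ne_zero_iff.2 hy
  have h2' : (2 - ‖y‖) ≠ 0 := by linarith
  have hd : HasDerivAt (fun r : ℝ => -M / (r * (2 - r) ^ 2))
      (M * ((2 - ‖y‖) ^ 2 - 2 * ‖y‖ * (2 - ‖y‖)) / (‖y‖ * (2 - ‖y‖) ^ 2) ^ 2) ‖y‖ := by
    have a := ((hasDerivAt_const ‖y‖ (-M)).fun_div
      ((hasDerivAt_id ‖y‖).fun_mul (((hasDerivAt_id ‖y‖).const_sub 2).fun_pow 2))
      (by simp only [id]; positivity))
    simp only [id] at a
    refine a.congr_deriv ?_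
    congr 1
    push_cast
    ring
  have h3 := hd.comp_hasFDerivAt y (bp_norm y hy)
  have h4 : HasFDerivAt (fun y : EuclideanSpace ℝ (Fin N) => y i)
    (EuclideanSpace.proj i : EuclideanSpace ℝ (Fin N) →L[ℝ] ℝ) y :=
    (EuclideanSpace.proj i : EuclideanSpace ℝ (Fin N) →L[ℝ] ℝ).hasFDerivAt
  have := (h4.fun_mul h3).fderiv
  simp only [Function.comp_def] at this
  rw [this]
  simp [EuclideanSpace.inner_single_right]
  field_simp
  ring

lemma bp_power {N : ℕ} (hN : 1 ≤ N) (p : ℝ) (hp : 2 < p) (t : Fin N → ℝ)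
    (ht : ∑ i, t i ^ 2 = 1) : (N : ℝ) ^ (1 - p / 2) ≤ ∑ i, |t i| ^ p := by
  have h1 := Real.rpow_sum_le_const_mul_sum_rpow (Finset.univ : Finset (Fin N))
    (fun i => t i ^ 2) (p := p / 2) (by linarith)
  simp only [abs_pow, sq_abs, ht, Real.one_rpow, Finset.card_univ, Fintype.card_fin] at h1
  have h2 : ∀ i, (t i ^ 2) ^ (p / 2) = |t i| ^ p := fun i => by
    rw [← sq_abs, ← Real.rpow_natCast, ← Real.rpow_mul (abs_nonneg _)]
    congr 1; push_cast; ring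
  simp only [h2] at h1
  have hN' : (0 : ℝ) < N := by exact_mod_cast hN
  have : (N : ℝ) ^ (1 - p / 2) = ((N : ℝ) ^ (p / 2 - 1))⁻¹ := by
    rw [← Real.rpow_neg hN'.le]; congr 1; ring
  rw [this, inv_le_iff_one_le_mul₀ (by positivity), mul_comm]
  exact h1

/-- **Pointwise barrier estimate.** For `p > 2`, `A ≥ 0`, `M > 0`, the function
`h x = A + M (1 - 1/(1 + d x))` with `d x = 1 - |x|` is `C²` near every `x ∈ B₁ \ {0}` and
satisfies `(p-1) Σᵢ |∂ᵢh(x)|^(p-2) ∂ᵢᵢh(x) ≤ -2^(-2p) M^(p-1) (p-1) N^(1-p/2)` there. -/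
theorem barrier_pointwise_estimate (N : ℕ) (hN : 1 ≤ N) (p : ℝ) (hp : 2 < p)
    (A M : ℝ) (hA : 0 ≤ A) (hM : 0 < M)
    (h : EuclideanSpace ℝ (Fin N) → ℝ)
    (hh : h = fun x => A + M * (1 - 1 / (1 + (1 - ‖x‖))))
    (x : EuclideanSpace ℝ (Fin N)) (hx : x ∈ ball (0 : EuclideanSpace ℝ (Fin N)) 1)
    (hx0 : x ≠ 0) :
    (∃ ε > 0, ContDiffOn ℝ 2 h (ball x ε)) ∧
    (p - 1) * pseudoPOp p h x ≤
      -((2 : ℝ) ^ (-(2 * p)) * M ^ (p - 1) * (p - 1) * (N : ℝ) ^ (1 - p / 2)) := by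
  have hn : 0 < ‖x‖ := norm_pos_iff.2 hx0
  have hx1 : ‖x‖ < 1 := by simpa using hx
  subst hh
  have hev : ∀ᶠ y : EuclideanSpace ℝ (Fin N) in 𝓝 x, y ≠ 0 ∧ ‖y‖ < 2 :=
    (isOpen_ne.eventually_mem hx0).and
      ((isOpen_lt continuous_norm continuous_const).eventually_mem
        (show ‖x‖ < 2 by linarith))
  constructor
  · obtain ⟨ε, hε, hb⟩ := Metric.eventually_nhds_iff_ball.1 hev
    refine ⟨ε, hε, fun y hy => ContDiffAt.contDiffWithinAt ?_⟩
    obtain ⟨h0, h2⟩ := hb y hy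
    have : ContDiffAt ℝ 2 (fun z : EuclideanSpace ℝ (Fin N) => ‖z‖) y := contDiffAt_norm ℝ h0
    refine contDiffAt_const.add (contDiffAt_const.mul (contDiffAt_const.sub
      (contDiffAt_const.div (contDiffAt_const.add (contDiffAt_const.sub this)) ?_)))
    linarith
  have hs : 0 < 2 - ‖x‖ := by linarith
  have hs2 : 2 - ‖x‖ ≤ 2 := by linarith
  set t : Fin N → ℝ := fun i => x i / ‖x‖ with htdef
  have ht : ∑ i, t i ^ 2 = 1 := by
    simp only [htdef, div_pow]
    rw [← Finset.sum_div, ← EuclideanSpace.real_norm_sq_eq]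
    field_simp
  have key : pseudoPOp p (fun x : EuclideanSpace ℝ (Fin N) => A + M * (1 - 1 / (1 + (1 - ‖x‖)))) x
      ≤ -((2 : ℝ) ^ (-(2 * p)) * M ^ (p - 1) * ∑ i, |t i| ^ p) := by
    unfold pseudoPOp
    rw [Finset.mul_sum, ← Finset.sum_neg_distrib]
    refine Finset.sum_le_sum fun i _ => ?_
    have hti : t i ^ 2 ≤ 1 := by
      rw [← ht]
      exact Finset.single_le_sum (f := fun i => t i ^ 2) (fun _ _ => sq_nonneg _) (Finset.mem_univ i)
    have he : (fun y => fderiv ℝ (fun x : EuclideanSpace ℝ (Fin N) =>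
        A + M * (1 - 1 / (1 + (1 - ‖x‖)))) y (EuclideanSpace.single i 1)) =ᶠ[𝓝 x]
        (fun y : EuclideanSpace ℝ (Fin N) => y i * (-M / (‖y‖ * (2 - ‖y‖) ^ 2))) :=
      hev.mono fun y hy => bp_first A M y hy.1 hy.2 i
    rw [he.fderiv_eq, bp_second M x hx0 (by linarith) i, bp_first A M x hx0 (by linarith) i]
    change _ * (-M * (2 * (t i) ^ 2 / (2 - ‖x‖) ^ 3
        + (1 - (t i) ^ 2) / (‖x‖ * (2 - ‖x‖) ^ 2))) ≤ _
    have e1 : |x i * (-M / (‖x‖ * (2 - ‖x‖) ^ 2))| = M / (2 - ‖x‖) ^ 2 * |t i| := by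
      have : x i * (-M / (‖x‖ * (2 - ‖x‖) ^ 2)) = -(M / (2 - ‖x‖) ^ 2 * t i) := by
        simp only [htdef]; field_simp
      rw [this, abs_neg, abs_mul, abs_of_pos (by positivity)]
    rw [e1, Real.mul_rpow (by positivity) (abs_nonneg _)]
    have e2 : (M / 4) ^ (p - 2) ≤ (M / (2 - ‖x‖) ^ 2) ^ (p - 2) := by
      apply Real.rpow_le_rpow (by positivity) _ (by linarith)
      apply div_le_div_of_nonneg_left hM.le (by positivity)
      nlinarith
    have e3 : 2 * (t i) ^ 2 / 8 ≤ 2 * (t i) ^ 2 / (2 - ‖x‖) ^ 3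
        + (1 - (t i) ^ 2) / (‖x‖ * (2 - ‖x‖) ^ 2) := by
      have a : 0 ≤ (1 - (t i) ^ 2) / (‖x‖ * (2 - ‖x‖) ^ 2) :=
        div_nonneg (by linarith) (by positivity)
      have b : 2 * (t i) ^ 2 / 8 ≤ 2 * (t i) ^ 2 / (2 - ‖x‖) ^ 3 := by
        apply div_le_div_of_nonneg_left (by positivity) (by positivity)
        calc (2 - ‖x‖) ^ 3 ≤ 2 ^ 3 := pow_le_pow_left₀ hs.le hs2 3
          _ = 8 := by norm_num
      linarith
    have e4 : |t i| ^ p = |t i| ^ (p - 2) * t i ^ 2 := by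
      have := Real.rpow_add_natCast' (abs_nonneg (t i)) (y := p - 2) (n := 2)
        (by push_cast; linarith)
      rw [← sq_abs, ← this]; congr 1; push_cast; ring
    have e5 : (2 : ℝ) ^ (-(2 * p)) * M ^ (p - 1) = (M / 4) ^ (p - 2) * M / 16 := by
      rw [Real.div_rpow hM.le (by norm_num), show (4 : ℝ) = 2 ^ (2 : ℝ) by norm_num,
        ← Real.rpow_mul (by norm_num), show p - 1 = (p - 2) + 1 by ring, Real.rpow_add_one hM.ne',
        show -(2 * p) = -(2 * (p - 2)) - (4 : ℕ) by push_cast; ring,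
        Real.rpow_sub_natCast (by norm_num), Real.rpow_neg (by norm_num)]
      field_simp
      norm_num
    rw [e5, e4]
    have f1 : (M / 4) ^ (p - 2) * |t i| ^ (p - 2) * (M * (2 * (t i) ^ 2 / 8)) ≤
        (M / (2 - ‖x‖) ^ 2) ^ (p - 2) * |t i| ^ (p - 2) * (M * (2 * (t i) ^ 2 / (2 - ‖x‖) ^ 3
        + (1 - (t i) ^ 2) / (‖x‖ * (2 - ‖x‖) ^ 2))) := by
      gcongr
    have f2 : 0 ≤ (M / 4) ^ (p - 2) * |t i| ^ (p - 2) * (M * (t i) ^ 2) := by positivity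
    linarith
  have hp1 : 0 < p - 1 := by linarith
  have hpow := bp_power hN p hp t ht
  have hc : 0 ≤ (2 : ℝ) ^ (-(2 * p)) * M ^ (p - 1) := by positivity
  have g1 := mul_le_mul_of_nonneg_left hpow hc
  have g2 := mul_le_mul_of_nonneg_left (key.trans (neg_le_neg g1)) hp1.le
  linarith
end

section
/- Let ω : [0,∞) → ℝ be continuous with ω(0) = 0, C² on (0,∞), with ω(s) > 0, ω′(s) > 0, ω″(s) < 0 for s ∈ (0,1). Let g(x) = ω(|x|), fix x ∈ ℝᴺ with 0 < |x| < 1, let H₁(x) = D²g(x), and let ι be a real number with 0 < ι ≤ 1/(4|H₁(x)|). Then there exist constants α ∈ (1/2, 3/2] and β ∈ [1/2, 3/2] such that H₁(x) + 2ι H₁(x)² = (β ω″(|x|) − α ω′(|x|)/|x|) (x ⊗ x)/|x|² + α (ω′(|x|)/|x|) Id. -/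
open Metric MeasureTheory Topology Filter Set

/-- The Hessian matrix of `g : ℝᴺ → ℝ` at `x`, with entries `∂ᵢⱼ g (x)`. -/
noncomputable def hess {N : ℕ} (g : EuclideanSpace ℝ (Fin N) → ℝ)
    (x : EuclideanSpace ℝ (Fin N)) : Matrix (Fin N) (Fin N) ℝ :=
  Matrix.of fun i j =>
    iteratedFDeriv ℝ 2 g x ![EuclideanSpace.single i 1, EuclideanSpace.single j 1]

/-- The norm `|A| = sup_{|v|=1} |ᵗv A v|` of a (symmetric) matrix, the supremum being over
unit vectors for the Euclidean norm. -/
noncomputable def symNorm {n : Type*} [Fintype n] (A : Matrix n n ℝ) : ℝ :=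
  sSup {r : ℝ | ∃ v : EuclideanSpace ℝ n, ‖v‖ = 1 ∧ r = |∑ i, ∑ j, v i * A i j * v j|}

lemma norm_hasFDerivAt_aux {N : ℕ} (y : EuclideanSpace ℝ (Fin N)) (hy : y ≠ 0) :
    HasFDerivAt (fun z : EuclideanSpace ℝ (Fin N) => ‖z‖) (‖y‖⁻¹ • innerSL ℝ y) y := by
  have h := (hasStrictFDerivAt_norm_sq y).hasFDerivAt
  have hn : 0 < ‖y‖ := norm_pos_iff.2 hy
  have h2 := h.sqrt (by positivity)
  have he : (fun z : EuclideanSpace ℝ (Fin N) => √(‖z‖ ^ 2)) = fun z => ‖z‖ := by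
    funext z
    exact Real.sqrt_sq (norm_nonneg z)
  rw [he] at h2
  have h3 : (1 / (2 * √(‖y‖ ^ 2))) • (2 • innerSL ℝ y) = ‖y‖⁻¹ • innerSL ℝ y := by
    rw [Real.sqrt_sq hn.le, ← Nat.cast_smul_eq_nsmul ℝ, smul_smul]
    congr 1
    push_cast
    field_simp
  rw [← h3]
  exact h2

lemma hess_radial {N : ℕ} (ω : ℝ → ℝ) (hω : ContDiffOn ℝ 2 ω (Ioi 0))
    (x : EuclideanSpace ℝ (Fin N)) (hx : 0 < ‖x‖) (i j : Fin N) :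
    hess (fun y : EuclideanSpace ℝ (Fin N) => ω ‖y‖) x i j =
      (deriv (deriv ω) ‖x‖ - deriv ω ‖x‖ / ‖x‖) * (x i * x j / ‖x‖ ^ 2) +
        deriv ω ‖x‖ / ‖x‖ * (1 : Matrix (Fin N) (Fin N) ℝ) i j := by
  have hd : ∀ r : ℝ, 0 < r → HasDerivAt ω (deriv ω r) r := fun r hr =>
    ((hω.differentiableOn (by norm_num)).differentiableAt (isOpen_Ioi.mem_nhds hr)).hasDerivAt
  have hdd : HasDerivAt (deriv ω) (deriv (deriv ω) ‖x‖) ‖x‖ := by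
    have h1 : ContDiffOn ℝ 1 (deriv ω) (Ioi 0) :=
      hω.deriv_of_isOpen isOpen_Ioi (by norm_num)
    exact ((h1.differentiableOn (by norm_num)).differentiableAt
      (isOpen_Ioi.mem_nhds hx)).hasDerivAt
  have hx0 : x ≠ 0 := norm_pos_iff.1 hx
  have hg : fderiv ℝ (fun y : EuclideanSpace ℝ (Fin N) => ω ‖y‖) =ᶠ[𝓝 x]
      fun y => (deriv ω ‖y‖ / ‖y‖) • innerSL ℝ y := by
    filter_upwards [isOpen_ne.mem_nhds hx0] with y hy
    have h := (hd ‖y‖ (norm_pos_iff.2 hy)).comp_hasFDerivAt y (norm_hasFDerivAt_aux y hy)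
    have h' : HasFDerivAt (fun y : EuclideanSpace ℝ (Fin N) => ω ‖y‖) _ y := h
    rw [h'.fderiv, smul_smul, div_eq_mul_inv]
  have hc : HasFDerivAt (fun y : EuclideanSpace ℝ (Fin N) => deriv ω ‖y‖ / ‖y‖) _ x :=
    (hdd.div (hasDerivAt_id ‖x‖) hx.ne').comp_hasFDerivAt x (norm_hasFDerivAt_aux x hx0)
  have hs := hc.smul (innerSL ℝ (E := EuclideanSpace ℝ (Fin N))).hasFDerivAt
  have hs' : HasFDerivAt (fun y : EuclideanSpace ℝ (Fin N) =>
    (deriv ω ‖y‖ / ‖y‖) • innerSL ℝ y) _ x := hs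
  simp only [hess, Matrix.of_apply]
  rw [iteratedFDeriv_two_apply, hg.fderiv_eq, hs'.fderiv]
  have hij : (EuclideanSpace.single i (1:ℝ)).ofLp j = (1 : Matrix (Fin N) (Fin N) ℝ) i j := by
    simp [Matrix.one_apply, eq_comm]
  have h1 : ∀ (u : EuclideanSpace ℝ (Fin N)) (k : Fin N),
      innerSL ℝ u (EuclideanSpace.single k (1 : ℝ)) = u k := by
    intro u k
    rw [innerSL_apply_apply, EuclideanSpace.inner_single_right]
    simp
  have key : ∀ (c d : ℝ) (L : EuclideanSpace ℝ (Fin N) →L[ℝ] EuclideanSpace ℝ (Fin N) →L[ℝ] ℝ),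
      (∀ u k, L u (EuclideanSpace.single k (1 : ℝ)) = u k) →
      (c • L + (d • ‖x‖⁻¹ • L x).smulRight (L x))
        (EuclideanSpace.single i (1 : ℝ)) (EuclideanSpace.single j (1 : ℝ)) =
      c * (1 : Matrix (Fin N) (Fin N) ℝ) i j + d * (‖x‖⁻¹ * x i) * x j := by
    intro c d L hL
    rw [← hij, ← hL x i, ← hL x j, ← hL (EuclideanSpace.single i (1 : ℝ)) j]
    rfl
  refine (key _ _ (innerSL ℝ) h1).trans ?_
  simp only [id]
  generalize (1 : Matrix (Fin N) (Fin N) ℝ) i j = m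
  field_simp
  ring

lemma quad_radial {N : ℕ} (a b : ℝ) (x v : EuclideanSpace ℝ (Fin N))
    (A : Matrix (Fin N) (Fin N) ℝ)
    (hA : ∀ i j, A i j = (a - b) * (x i * x j / ‖x‖ ^ 2) +
      b * (1 : Matrix (Fin N) (Fin N) ℝ) i j) :
    ∑ i, ∑ j, v i * A i j * v j =
      (a - b) * (inner ℝ x v ^ 2 / ‖x‖ ^ 2) + b * ‖v‖ ^ 2 := by
  have h1 : inner ℝ x v = ∑ i, x i * v i := by
    simp [PiLp.inner_apply, mul_comm]
  have h2 : ‖v‖ ^ 2 = ∑ i, v i * v i := by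
    rw [EuclideanSpace.norm_sq_eq]; simp [sq]
  have h3 : ∀ i j, v i * A i j * v j = (a - b) / ‖x‖ ^ 2 * ((x i * v i) * (x j * v j)) +
      b * (v i * (1 : Matrix (Fin N) (Fin N) ℝ) i j * v j) := by
    intro i j
    rw [hA]
    ring
  simp only [h3, Finset.sum_add_distrib, ← Finset.mul_sum]
  rw [h1, h2, sq (∑ i, x i * v i), Finset.sum_mul_sum]
  simp only [Finset.mul_sum, Matrix.one_apply]
  simp [Finset.mul_sum, Finset.sum_div]
  refine Finset.sum_congr rfl fun i _ => Finset.sum_congr rfl fun j _ => ?_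
  ring

lemma le_symNorm_radial {N : ℕ} (a b : ℝ) (x v : EuclideanSpace ℝ (Fin N)) (hx : 0 < ‖x‖)
    (hv : ‖v‖ = 1) (A : Matrix (Fin N) (Fin N) ℝ)
    (hA : ∀ i j, A i j = (a - b) * (x i * x j / ‖x‖ ^ 2) +
      b * (1 : Matrix (Fin N) (Fin N) ℝ) i j) :
    |(a - b) * (inner ℝ x v ^ 2 / ‖x‖ ^ 2) + b| ≤ symNorm A := by
  unfold symNorm
  apply le_csSup
  · refine ⟨|a - b| + |b|, ?_⟩
    rintro r ⟨w, hw, rfl⟩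
    rw [quad_radial a b x w A hA, hw]
    have h1 : inner ℝ x w ^ 2 / ‖x‖ ^ 2 ≤ 1 := by
      rw [div_le_one (by positivity), sq_le_sq]
      have := abs_real_inner_le_norm x w
      rw [hw, mul_one] at this
      rwa [abs_of_pos hx]
    have h0 : 0 ≤ inner ℝ x w ^ 2 / ‖x‖ ^ 2 := by positivity
    refine (abs_add_le _ _).trans ?_
    rw [abs_mul, abs_of_nonneg h0]
    have := mul_le_mul_of_nonneg_left h1 (abs_nonneg (a - b))
    simp only [one_pow, mul_one] at this ⊢
    linarith
  · exact ⟨v, hv, by rw [quad_radial a b x v A hA, hv]; simp⟩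

lemma exists_unit_orthogonal {N : ℕ} (hN : 2 ≤ N) (x : EuclideanSpace ℝ (Fin N)) :
    ∃ v : EuclideanSpace ℝ (Fin N), ‖v‖ = 1 ∧ inner ℝ x v = 0 := by
  have h : (ℝ ∙ x)ᗮ ≠ ⊥ := by
    intro h
    have h1 := Submodule.finrank_add_finrank_orthogonal (ℝ ∙ x)
    rw [h, finrank_bot, finrank_euclideanSpace_fin] at h1
    have h2 := finrank_span_le_card (R := ℝ) ({x} : Set (EuclideanSpace ℝ (Fin N)))
    simp only [Set.toFinset_singleton, Finset.card_singleton] at h2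
    omega
  obtain ⟨w, hw, hw0⟩ := Submodule.exists_mem_ne_zero_of_ne_bot h
  refine ⟨‖w‖⁻¹ • w, ?_, ?_⟩
  · simp [norm_smul, hw0]
  · rw [inner_smul_right, Submodule.mem_orthogonal_singleton_iff_inner_right.1 hw, mul_zero]

/-- **Formula (3.1): the perturbed Hessian.** With `ω` and `g x = ω |x|` as above,
`H₁ x = D²g x` and `0 < ι ≤ 1/(4|H₁ x|)`, there are constants `α ∈ (1/2, 3/2]` and
`β ∈ [1/2, 3/2]` such that
`H₁ + 2ι H₁² = (β ω''(|x|) - α ω'(|x|)/|x|) (x ⊗ x)/|x|² + α (ω'(|x|)/|x|) Id`. -/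
theorem perturbed_hessian_formula (N : ℕ) (hN : 1 ≤ N)
    (ω : ℝ → ℝ) (hω_cont : ContinuousOn ω (Ici 0)) (hω0 : ω 0 = 0)
    (hω_smooth : ContDiffOn ℝ 2 ω (Ioi 0))
    (hω_pos : ∀ s ∈ Ioo (0 : ℝ) 1, 0 < ω s)
    (hω'_pos : ∀ s ∈ Ioo (0 : ℝ) 1, 0 < deriv ω s)
    (hω''_neg : ∀ s ∈ Ioo (0 : ℝ) 1, deriv (deriv ω) s < 0)
    (x : EuclideanSpace ℝ (Fin N)) (hx : 0 < ‖x‖) (hx1 : ‖x‖ < 1)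
    (ι : ℝ) (hι0 : 0 < ι)
    (hι : ι ≤ 1 / (4 * symNorm (hess (fun y : EuclideanSpace ℝ (Fin N) => ω ‖y‖) x))) :
    ∃ α ∈ Ioc (1/2 : ℝ) (3/2), ∃ β ∈ Icc (1/2 : ℝ) (3/2),
      hess (fun y : EuclideanSpace ℝ (Fin N) => ω ‖y‖) x +
          (2 * ι) • hess (fun y : EuclideanSpace ℝ (Fin N) => ω ‖y‖) x ^ 2 =
        (β * deriv (deriv ω) ‖x‖ - α * (deriv ω ‖x‖ / ‖x‖)) •
            Matrix.of (fun i j => x i * x j / ‖x‖ ^ 2) +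
          (α * (deriv ω ‖x‖ / ‖x‖)) • (1 : Matrix (Fin N) (Fin N) ℝ) := by
  set H := hess (fun y : EuclideanSpace ℝ (Fin N) => ω ‖y‖) x with hH
  have hA := hess_radial ω hω_smooth x hx
  rw [← hH] at hA
  have hb : 0 < deriv ω ‖x‖ / ‖x‖ := div_pos (hω'_pos _ ⟨hx, hx1⟩) hx
  have ha := hω''_neg _ ⟨hx, hx1⟩
  generalize deriv ω ‖x‖ / ‖x‖ = b at *
  generalize deriv (deriv ω) ‖x‖ = a at *
  set P : Matrix (Fin N) (Fin N) ℝ := Matrix.of (fun i j => x i * x j / ‖x‖ ^ 2) with hP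
  have hHP : H = (a - b) • P + b • (1 : Matrix (Fin N) (Fin N) ℝ) := by
    ext i j
    rw [hA]
    simp [hP]
  have hxx : ∑ i, x i * x i = ‖x‖ ^ 2 := by
    rw [EuclideanSpace.norm_sq_eq]; simp [sq]
  have hPP : P * P = P := by
    ext i j
    simp only [hP, Matrix.mul_apply, Matrix.of_apply]
    have : ∀ k, x i * x k / ‖x‖ ^ 2 * (x k * x j / ‖x‖ ^ 2) =
        x i * x j / ‖x‖ ^ 2 / ‖x‖ ^ 2 * (x k * x k) := fun k => by ring
    simp only [this, ← Finset.mul_sum, hxx]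
    field_simp
  have hsq : H + (2 * ι) • H ^ 2 =
      ((1 + 2 * ι * a) * a - (1 + 2 * ι * b) * b) • P +
        ((1 + 2 * ι * b) * b) • (1 : Matrix (Fin N) (Fin N) ℝ) := by
    rw [hHP, sq]
    simp only [add_mul, mul_add, smul_mul_assoc, mul_smul_comm, hPP, mul_one, one_mul]
    module
  have haS : -a ≤ symNorm H := by
    have h := le_symNorm_radial a b x (‖x‖⁻¹ • x) hx
      (by simp [norm_smul, hx.ne']) H hA
    rw [inner_smul_right, real_inner_self_eq_norm_sq] at h
    have h2 : (‖x‖⁻¹ * ‖x‖ ^ 2) ^ 2 / ‖x‖ ^ 2 = 1 := by field_simp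
    rw [h2] at h
    have := neg_abs_le ((a - b) * 1 + b)
    linarith
  have hS : 0 < symNorm H := by linarith
  have hιS : ι * symNorm H ≤ 1 / 4 := by
    rw [le_div_iff₀ (by positivity)] at hι
    linarith
  have hιa : ι * (-a) ≤ 1 / 4 := (mul_le_mul_of_nonneg_left haS hι0.le).trans hιS
  have hιa0 : 0 ≤ ι * (-a) := mul_nonneg hι0.le (by linarith)
  have hβ : 1 + 2 * ι * a ∈ Icc (1/2 : ℝ) (3/2) := ⟨by linarith, by linarith⟩
  rcases Nat.lt_or_ge N 2 with h2 | h2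
  · obtain rfl : N = 1 := by omega
    have hP1 : P = 1 := by
      ext i j
      obtain rfl := Subsingleton.elim i 0
      obtain rfl := Subsingleton.elim j 0
      simp only [Fin.sum_univ_one] at hxx
      simp [hP, hxx, hx.ne']
    refine ⟨1, ⟨by norm_num, by norm_num⟩, _, hβ, ?_⟩
    rw [hsq, hP1]
    module
  · obtain ⟨v, hv, hxv⟩ := exists_unit_orthogonal h2 x
    have h := le_symNorm_radial a b x v hx hv H hA
    rw [hxv] at h
    have hbS : b ≤ symNorm H := by
      refine le_trans ?_ h
      simpa using le_abs_self b
    have hιb : ι * b ≤ 1 / 4 := (mul_le_mul_of_nonneg_left hbS hι0.le).trans hιS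
    have hιb0 : 0 < ι * b := mul_pos hι0 hb
    exact ⟨1 + 2 * ι * b, ⟨by linarith, by linarith⟩, _, hβ, hsq⟩
end

section
/- Let 2 < p ≤ 4 and N ≥ 1. Let ω : [0,∞) → ℝ be continuous with ω(0) = 0, C² on (0,∞), with ω(s) > 0, ω′(s) > 0, ω″(s) < 0 for s ∈ (0,1). Fix x ∈ ℝᴺ with 0 < |x| < 1 and constants α ∈ (1/2, 3/2], β ∈ [1/2, 3/2]. Let H̃(x) = (β ω″(|x|) − α ω′(|x|)/|x|) (x ⊗ x)/|x|² + α (ω′(|x|)/|x|) Id, let Θ(x) be the diagonal N×N matrix with entries Θᵢᵢ = |ω′(|x|) xᵢ/|x||^{(p−2)/2}, and let H(x) = Θ(x) H̃(x) Θ(x). Then the symmetric matrix H(x) has at least one eigenvalue less than or equal to N^{1−p/2} β ω″(|x|) (ω′(|x|))^{p−2} (which is negative). -/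
open Metric MeasureTheory Topology Filter Set

lemma exists_small_eig {N : ℕ} (H : Matrix (Fin N) (Fin N) ℝ) (hH : H.IsHermitian) (m : ℝ)
    (v : Fin N → ℝ) (hv : v ≠ 0) (h : v ⬝ᵥ (H.mulVec v) ≤ m * (v ⬝ᵥ v)) :
    ∃ μ : ℝ, μ ≤ m ∧ ∃ v : Fin N → ℝ, v ≠ 0 ∧ H.mulVec v = μ • v := by
  classical
  have hA : (H - m • (1 : Matrix (Fin N) (Fin N) ℝ)).IsHermitian := by
    apply hH.sub
    simp [Matrix.IsHermitian]
  by_contra hcon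
  push Not at hcon
  have hpd : (H - m • (1 : Matrix (Fin N) (Fin N) ℝ)).PosDef := by
    rw [hA.posDef_iff_eigenvalues_pos]
    intro i
    by_contra hi
    push Not at hi
    have h1 := hA.mulVec_eigenvectorBasis i
    refine hcon (hA.eigenvalues i + m) (by linarith) (hA.eigenvectorBasis i) ?_ ?_
    · intro h0
      apply hA.eigenvectorBasis.toBasis.ne_zero i
      ext j
      simpa using congrFun h0 j
    · rw [Matrix.sub_mulVec, Matrix.smul_mulVec, Matrix.one_mulVec] at h1
      rw [add_smul, ← h1]
      simp
  have h2 := hpd.dotProduct_mulVec_pos hv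
  rw [Matrix.sub_mulVec, Matrix.smul_mulVec, Matrix.one_mulVec, dotProduct_sub,
    dotProduct_smul] at h2
  simp only [star_trivial, smul_eq_mul] at h2
  linarith

lemma term_bound {N : ℕ} (hN : 1 ≤ N) (a t u : ℝ) (ha : 0 < a) (ht : 0 < t) (ht1 : t ≤ 1) :
    (N : ℝ) ^ (-t) * a ^ (2 * t) * (u * (|a * u| ^ t)⁻¹) ^ 2 ≤ (1 - t) * u ^ 2 + t * (N : ℝ)⁻¹ := by
  have hN' : (0 : ℝ) < N := by exact_mod_cast hN
  have h := Real.geom_mean_le_arith_mean2_weighted (w₁ := 1 - t) (w₂ := t) (p₁ := u ^ 2)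
    (p₂ := (N : ℝ)⁻¹) (by linarith) ht.le (sq_nonneg u) (by positivity) (by ring)
  by_cases hu : u = 0
  · subst hu
    simp only [zero_mul]
    have : 0 ≤ t * (N : ℝ)⁻¹ := by positivity
    simpa using this
  refine le_trans (le_of_eq ?_) h
  have hu' : 0 < |u| := abs_pos.mpr hu
  rw [Real.inv_rpow hN'.le, ← Real.rpow_neg hN'.le, abs_mul, abs_of_pos ha,
    Real.mul_rpow ha.le hu'.le, Real.rpow_sub (by positivity), Real.rpow_one, two_mul,
    Real.rpow_add ha, ← sq_abs u, ← Real.rpow_natCast_mul hu'.le, Nat.cast_ofNat, two_mul,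
    Real.rpow_add hu']
  have h1 : 0 < a ^ t := Real.rpow_pos_of_pos ha t
  have h2 : 0 < |u| ^ t := Real.rpow_pos_of_pos hu' t
  rw [mul_pow, ← sq_abs u]
  field_simp

/-- **Proposition 3.1, case `2 < p ≤ 4`.** With `ω` as above, `0 < |x| < 1`,
`H̃ = (β ω'' - α ω'/|x|)(x⊗x)/|x|² + α (ω'/|x|) Id` and `Θ` the diagonal matrix with entries
`|ω'(|x|) xᵢ/|x||^((p-2)/2)`, the matrix `H = Θ H̃ Θ` has at least one eigenvalue
`≤ N^(1-p/2) β ω''(|x|) (ω'(|x|))^(p-2)`. -/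
theorem small_eigenvalue_p_le_four (N : ℕ) (hN : 1 ≤ N) (p : ℝ) (hp : 2 < p) (hp4 : p ≤ 4)
    (ω : ℝ → ℝ) (hω_cont : ContinuousOn ω (Ici 0)) (hω0 : ω 0 = 0)
    (hω_smooth : ContDiffOn ℝ 2 ω (Ioi 0))
    (hω_pos : ∀ s ∈ Ioo (0 : ℝ) 1, 0 < ω s)
    (hω'_pos : ∀ s ∈ Ioo (0 : ℝ) 1, 0 < deriv ω s)
    (hω''_neg : ∀ s ∈ Ioo (0 : ℝ) 1, deriv (deriv ω) s < 0)
    (x : EuclideanSpace ℝ (Fin N)) (hx : 0 < ‖x‖) (hx1 : ‖x‖ < 1)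
    (α β : ℝ) (hα : α ∈ Ioc (1/2 : ℝ) (3/2)) (hβ : β ∈ Icc (1/2 : ℝ) (3/2))
    (Ht Θ H : Matrix (Fin N) (Fin N) ℝ)
    (hHt : Ht = (β * deriv (deriv ω) ‖x‖ - α * (deriv ω ‖x‖ / ‖x‖)) •
        Matrix.of (fun i j => x i * x j / ‖x‖ ^ 2) +
      (α * (deriv ω ‖x‖ / ‖x‖)) • (1 : Matrix (Fin N) (Fin N) ℝ))
    (hΘ : Θ = Matrix.diagonal fun i => |deriv ω ‖x‖ * x i / ‖x‖| ^ ((p - 2) / 2))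
    (hH : H = Θ * Ht * Θ) :
    ∃ μ : ℝ, μ ≤ (N : ℝ) ^ (1 - p / 2) * β * deriv (deriv ω) ‖x‖ * deriv ω ‖x‖ ^ (p - 2) ∧
      ∃ v : Fin N → ℝ, v ≠ 0 ∧ H.mulVec v = μ • v := by
  have hs : ‖x‖ ∈ Ioo (0 : ℝ) 1 := ⟨hx, hx1⟩
  have ha := hω'_pos _ hs
  have hc' := hω''_neg _ hs
  have hN' : (0 : ℝ) < N := by exact_mod_cast hN
  generalize deriv ω ‖x‖ = a at *
  generalize deriv (deriv ω) ‖x‖ = d at *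
  have hc : β * d < 0 := mul_neg_of_pos_of_neg (by linarith [hβ.1]) hc'
  obtain ⟨t, rfl⟩ : ∃ t, p = 2 * t + 2 := ⟨(p - 2) / 2, by ring⟩
  have ht : 0 < t := by linarith
  have ht1 : t ≤ 1 := by linarith
  have e1 : (2 * t + 2 - 2) / 2 = t := by ring
  have e2 : 1 - (2 * t + 2) / 2 = -t := by ring
  have e3 : 2 * t + 2 - 2 = 2 * t := by ring
  rw [e1] at hΘ
  rw [e2, e3]
  generalize α * (a / ‖x‖) = b at *
  let u : Fin N → ℝ := fun i => x i / ‖x‖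
  have hu : ∑ i, u i ^ 2 = 1 := by
    simp only [u, div_pow, ← Finset.sum_div]
    rw [← EuclideanSpace.real_norm_sq_eq]
    field_simp
  have huu : u ⬝ᵥ u = 1 := by
    rw [← hu]; simp [dotProduct, sq]
  have hHt' : Ht = (β * d - b) • Matrix.vecMulVec u u + b • (1 : Matrix (Fin N) (Fin N) ℝ) := by
    rw [hHt]
    congr 2
    ext i j
    simp only [Matrix.of_apply, Matrix.vecMulVec_apply, u]
    field_simp
  have hΘ' : Θ = Matrix.diagonal fun i => |a * u i| ^ t := by
    rw [hΘ]
    simp only [u, mul_div_assoc]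
  let v : Fin N → ℝ := fun i => u i * (|a * u i| ^ t)⁻¹
  have hΘv : Θ.mulVec v = u := by
    ext i
    rw [hΘ', Matrix.mulVec_diagonal]
    by_cases h0 : u i = 0
    · simp [v, h0]
    · have : 0 < |a * u i| ^ t := Real.rpow_pos_of_pos (abs_pos.mpr (mul_ne_zero ha.ne' h0)) t
      simp only [v]
      field_simp
  have hv : v ≠ 0 := by
    intro h0
    rw [h0, Matrix.mulVec_zero] at hΘv
    rw [← hΘv] at huu
    simp at huu
  have hΘT : Θ.transpose = Θ := by rw [hΘ', Matrix.diagonal_transpose]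
  have hHtT : Ht.transpose = Ht := by
    rw [hHt', Matrix.transpose_add, Matrix.transpose_smul, Matrix.transpose_smul,
      Matrix.transpose_one, Matrix.transpose_vecMulVec]
  have hHh : H.IsHermitian := by
    rw [Matrix.IsHermitian, Matrix.conjTranspose_eq_transpose_of_trivial, hH,
      Matrix.transpose_mul, Matrix.transpose_mul, hΘT, hHtT, Matrix.mul_assoc]
  have hq : v ⬝ᵥ H.mulVec v = β * d := by
    rw [hH, ← Matrix.mulVec_mulVec, ← Matrix.mulVec_mulVec, hΘv, Matrix.dotProduct_mulVec,
      ← Matrix.mulVec_transpose, hΘT, hΘv, hHt', Matrix.add_mulVec, Matrix.smul_mulVec,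
      Matrix.smul_mulVec, Matrix.one_mulVec, Matrix.vecMulVec_mulVec, huu]
    simp [huu]
  refine exists_small_eig H hHh _ v hv ?_
  rw [hq]
  have hb : (N : ℝ) ^ (-t) * a ^ (2 * t) * (v ⬝ᵥ v) ≤ 1 := by
    calc (N : ℝ) ^ (-t) * a ^ (2 * t) * (v ⬝ᵥ v)
        = ∑ i, (N : ℝ) ^ (-t) * a ^ (2 * t) * (u i * (|a * u i| ^ t)⁻¹) ^ 2 := by
          rw [← Finset.mul_sum]; simp [dotProduct, v, sq]
      _ ≤ ∑ i, ((1 - t) * u i ^ 2 + t * (N : ℝ)⁻¹) :=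
          Finset.sum_le_sum fun i _ => term_bound hN a t (u i) ha ht ht1
      _ = 1 := by
          rw [Finset.sum_add_distrib, ← Finset.mul_sum, hu]
          simp
          field_simp
          ring
  nlinarith [mul_le_mul_of_nonpos_left hb hc.le]
end

section
/- Let p > 4 and N ≥ 1. Let ω : [0,∞) → ℝ be continuous with ω(0) = 0, C² on (0,∞), with ω(s) > 0, ω′(s) > 0, ω″(s) < 0 for s ∈ (0,1). Fix x ∈ ℝᴺ with 0 < |x| < 1, constants α ∈ (1/2, 3/2], β ∈ [1/2, 3/2], and ε > 0 such that the set I(x,ε) = { i ∈ {1,…,N} : |xᵢ| ≥ |x|^{1+ε} } is nonempty and such that β ω″(|x|)(1 − N|x|^{2ε}) + α N |x|^{2ε} ω′(|x|)/|x| ≤ ω″(|x|)/4 < 0. Let H̃(x) = (β ω″(|x|) − α ω′(|x|)/|x|) (x ⊗ x)/|x|² + α (ω′(|x|)/|x|) Id, let Θ(x) be the diagonal N×N matrix with entries Θᵢᵢ = |ω′(|x|) xᵢ/|x||^{(p−2)/2}, and let H(x) = Θ(x) H̃(x) Θ(x). Then H(x) has at least one eigenvalue less than or equal to ((1 − N|x|^{2ε})/#I(x,ε))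 (ω′(|x|))^{p−2} |x|^{(p−4)ε} ω″(|x|)/4. -/
open Metric MeasureTheory Topology Filter Set

/-- If a symmetric matrix has a vector with Rayleigh quotient at most `c`, it has an
eigenvalue at most `c`. -/
theorem exists_eigenvalue_le {N : ℕ} (H : Matrix (Fin N) (Fin N) ℝ) (hH : H.IsHermitian)
    (c : ℝ) (v : Fin N → ℝ) (hv : v ≠ 0) (hle : v ⬝ᵥ H.mulVec v ≤ c * (v ⬝ᵥ v)) :
    ∃ μ : ℝ, μ ≤ c ∧ ∃ w : Fin N → ℝ, w ≠ 0 ∧ H.mulVec w = μ • w := by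
  have hA : (H - c • (1 : Matrix (Fin N) (Fin N) ℝ)).IsHermitian := by
    refine hH.sub ?_
    ext i j
    by_cases h : i = j <;> simp [Matrix.one_apply, h, eq_comm]
  have hnot : ¬ (H - c • (1 : Matrix (Fin N) (Fin N) ℝ)).PosDef := by
    intro hp
    have := hp.dotProduct_mulVec_pos hv
    rw [Matrix.sub_mulVec, Matrix.smul_mulVec, Matrix.one_mulVec, dotProduct_sub,
      dotProduct_smul] at this
    simp only [star_trivial, smul_eq_mul] at this
    linarith
  rw [hA.posDef_iff_eigenvalues_pos] at hnot
  push Not at hnot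
  obtain ⟨i, hi⟩ := hnot
  refine ⟨hA.eigenvalues i + c, by linarith, (hA.eigenvectorBasis i).ofLp, ?_, ?_⟩
  · intro h0
    apply hA.eigenvectorBasis.orthonormal.ne_zero i
    ext j
    exact congrFun h0 j
  · have := hA.mulVec_eigenvectorBasis i
    rw [Matrix.sub_mulVec, Matrix.smul_mulVec, Matrix.one_mulVec] at this
    rw [add_smul, ← this]
    simp

/-- **Proposition 3.1, case `p > 4`.** With `ω` as above, `0 < |x| < 1`, `ε > 0` such that
`I(x,ε) = {i : |xᵢ| ≥ |x|^(1+ε)}` is nonempty and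
`β ω''(|x|)(1 - N|x|^(2ε)) + α N |x|^(2ε) ω'(|x|)/|x| ≤ ω''(|x|)/4 < 0`, the matrix
`H = Θ H̃ Θ` has at least one eigenvalue
`≤ ((1 - N|x|^(2ε))/#I(x,ε)) (ω'(|x|))^(p-2) |x|^((p-4)ε) ω''(|x|)/4`. -/
theorem small_eigenvalue_p_gt_four (N : ℕ) (hN : 1 ≤ N) (p : ℝ) (hp : 4 < p)
    (ω : ℝ → ℝ) (hω_cont : ContinuousOn ω (Ici 0)) (hω0 : ω 0 = 0)
    (hω_smooth : ContDiffOn ℝ 2 ω (Ioi 0))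
    (hω_pos : ∀ s ∈ Ioo (0 : ℝ) 1, 0 < ω s)
    (hω'_pos : ∀ s ∈ Ioo (0 : ℝ) 1, 0 < deriv ω s)
    (hω''_neg : ∀ s ∈ Ioo (0 : ℝ) 1, deriv (deriv ω) s < 0)
    (x : EuclideanSpace ℝ (Fin N)) (hx : 0 < ‖x‖) (hx1 : ‖x‖ < 1)
    (α β : ℝ) (hα : α ∈ Ioc (1/2 : ℝ) (3/2)) (hβ : β ∈ Icc (1/2 : ℝ) (3/2))
    (ε : ℝ) (hε : 0 < ε)
    (hInonempty : (Finset.univ.filter fun i : Fin N => ‖x‖ ^ (1 + ε) ≤ |x i|).Nonempty)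
    (hcond : β * deriv (deriv ω) ‖x‖ * (1 - N * ‖x‖ ^ (2 * ε)) +
        α * N * ‖x‖ ^ (2 * ε) * (deriv ω ‖x‖ / ‖x‖) ≤ deriv (deriv ω) ‖x‖ / 4)
    (hcond' : deriv (deriv ω) ‖x‖ / 4 < 0)
    (Ht Θ H : Matrix (Fin N) (Fin N) ℝ)
    (hHt : Ht = (β * deriv (deriv ω) ‖x‖ - α * (deriv ω ‖x‖ / ‖x‖)) •
        Matrix.of (fun i j => x i * x j / ‖x‖ ^ 2) +
      (α * (deriv ω ‖x‖ / ‖x‖)) • (1 : Matrix (Fin N) (Fin N) ℝ))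
    (hΘ : Θ = Matrix.diagonal fun i => |deriv ω ‖x‖ * x i / ‖x‖| ^ ((p - 2) / 2))
    (hH : H = Θ * Ht * Θ) :
    ∃ μ : ℝ, μ ≤ ((1 - N * ‖x‖ ^ (2 * ε)) /
          (Finset.univ.filter fun i : Fin N => ‖x‖ ^ (1 + ε) ≤ |x i|).card) *
        deriv ω ‖x‖ ^ (p - 2) * ‖x‖ ^ ((p - 4) * ε) * (deriv (deriv ω) ‖x‖ / 4) ∧
      ∃ v : Fin N → ℝ, v ≠ 0 ∧ H.mulVec v = μ • v := by
  have hmem : ‖x‖ ∈ Ioo (0 : ℝ) 1 := ⟨hx, hx1⟩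
  have ha := hω'_pos _ hmem
  have hb := hω''_neg _ hmem
  clear hω_cont hω0 hω_smooth hω_pos hω'_pos hω''_neg hcond'
  have hnorm : ∑ i, (x i) ^ 2 = ‖x‖ ^ 2 := by
    rw [EuclideanSpace.norm_sq_eq]; simp
  generalize deriv (deriv ω) ‖x‖ = b at *
  generalize deriv ω ‖x‖ = a at *
  generalize ‖x‖ = r at *
  set I := (Finset.univ.filter fun i : Fin N => r ^ (1 + ε) ≤ |x i|) with hI
  set u : Fin N → ℝ := fun i => x i / r with hu
  set θ : Fin N → ℝ := fun i => |a * x i / r| ^ ((p - 2) / 2) with hθ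
  have hre : 0 < r ^ ε := Real.rpow_pos_of_pos hx _
  have huI : ∀ i ∈ I, r ^ ε ≤ |u i| := by
    intro i hi
    have h1 : r ^ (1 + ε) ≤ |x i| := (Finset.mem_filter.mp hi).2
    rw [hu]; simp only
    rw [abs_div, abs_of_pos hx, le_div_iff₀ hx]
    rw [Real.rpow_add hx, Real.rpow_one] at h1
    linarith
  have huN : ∀ i, i ∉ I → u i ^ 2 ≤ r ^ (2 * ε) := by
    intro i hi
    have h1 : |x i| < r ^ (1 + ε) := by
      by_contra h; exact hi (Finset.mem_filter.mpr ⟨Finset.mem_univ _, not_lt.mp h⟩)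
    have h2 : |u i| ≤ r ^ ε := by
      rw [hu]; simp only
      rw [abs_div, abs_of_pos hx, div_le_iff₀ hx]
      rw [Real.rpow_add hx, Real.rpow_one] at h1
      linarith
    rw [mul_comm, Real.rpow_mul hx.le, Real.rpow_two, ← sq_abs]
    exact pow_le_pow_left₀ (abs_nonneg _) h2 2
  have husum : ∑ i, u i ^ 2 = 1 := by
    simp only [hu, div_pow]
    rw [← Finset.sum_div, hnorm, div_self (by positivity)]
  set s := ∑ i ∈ I, u i ^ 2 with hs
  have hs_ge : 1 - N * r ^ (2 * ε) ≤ s := by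
    have h1 : s + ∑ i ∈ Iᶜ, u i ^ 2 = 1 := by
      rw [hs, Finset.sum_add_sum_compl, husum]
    have h2 : ∑ i ∈ Iᶜ, u i ^ 2 ≤ ∑ i : Fin N, r ^ (2 * ε) := by
      refine (Finset.sum_le_sum fun i hi => huN i (Finset.mem_compl.mp hi)).trans ?_
      exact Finset.sum_le_sum_of_subset_of_nonneg (Finset.subset_univ _)
        (fun _ _ _ => by positivity)
    simp at h2
    linarith
  have hs0 : 0 ≤ s := Finset.sum_nonneg fun i _ => sq_nonneg _
  set K := a ^ (p - 2) * r ^ ((p - 4) * ε) with hK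
  have hKpos : 0 < K := by positivity
  have hθu : ∀ i, θ i = (a * |u i|) ^ ((p - 2) / 2) := by
    intro i
    simp only [hθ, hu]
    rw [mul_div_assoc, abs_mul, abs_of_pos ha]
  have hθpos : ∀ i ∈ I, 0 < θ i := by
    intro i hi
    rw [hθu]
    exact Real.rpow_pos_of_pos (mul_pos ha (hre.trans_le (huI i hi))) _
  have hθK : ∀ i ∈ I, K * u i ^ 2 ≤ θ i ^ 2 := by
    intro i hi
    have h0 : 0 < |u i| := hre.trans_le (huI i hi)
    have h1 : θ i ^ 2 = a ^ (p - 2) * (|u i| ^ (p - 4) * u i ^ 2) := by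
      rw [hθu, ← Real.rpow_natCast, ← Real.rpow_mul (by positivity),
        Real.mul_rpow ha.le h0.le, ← sq_abs (u i), ← Real.rpow_natCast |u i|,
        ← Real.rpow_add h0]
      congr 2 <;> push_cast <;> ring
    have h2 : r ^ ((p - 4) * ε) ≤ |u i| ^ (p - 4) := by
      rw [mul_comm, Real.rpow_mul hx.le]
      exact Real.rpow_le_rpow hre.le (huI i hi) (by linarith)
    rw [h1, hK, mul_assoc]
    gcongr
  set v : Fin N → ℝ := fun i => if i ∈ I then u i / θ i else 0 with hv
  set ξ : Fin N → ℝ := fun i => if i ∈ I then u i else 0 with hξ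
  have hn : (0 : ℝ) < I.card := by exact_mod_cast hInonempty.card_pos
  have hD : K * (v ⬝ᵥ v) ≤ I.card := by
    have h1 : K * (v ⬝ᵥ v) = ∑ i ∈ I, K * (u i ^ 2 / θ i ^ 2) := by
      rw [dotProduct, Finset.mul_sum, ← Finset.sum_filter_add_sum_filter_not _ (· ∈ I)]
      rw [Finset.sum_eq_zero (s := Finset.univ.filter (· ∉ I)), add_zero]
      · rw [Finset.filter_mem_eq_inter, Finset.univ_inter]
        refine Finset.sum_congr rfl fun i hi => ?_
        simp only [hv, if_pos hi]
        ring
      · intro i hi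
        simp [hv, (Finset.mem_filter.mp hi).2]
    rw [h1]
    calc _ ≤ ∑ i ∈ I, (1 : ℝ) := by
          refine Finset.sum_le_sum fun i hi => ?_
          rw [← mul_div_assoc, div_le_one (pow_pos (hθpos i hi) 2)]
          exact hθK i hi
      _ = _ := by simp
  have hvne : v ≠ 0 := by
    obtain ⟨i, hi⟩ := hInonempty
    intro h
    have h1 := congrFun h i
    simp only [hv, if_pos hi, Pi.zero_apply] at h1
    have h0 : 0 < |u i| := hre.trans_le (huI i hi)
    exact div_ne_zero (abs_pos.mp h0) (hθpos i hi).ne' h1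
  have hHsym : H.IsHermitian := by
    have h1 : Ht.IsHermitian := by
      rw [hHt]
      ext i j
      by_cases h : i = j
      · simp [h]
      · simp [Matrix.one_apply, h, Ne.symm h, mul_comm]
    have h2 : Θ.conjTranspose = Θ := by rw [hΘ]; simp
    have := Matrix.isHermitian_conjTranspose_mul_mul Θ h1
    rwa [h2, ← hH] at this
  have hΘv : Θ.mulVec v = ξ := by
    ext i
    rw [hΘ, Matrix.mulVec_diagonal]
    by_cases hi : i ∈ I
    · simp only [hv, hξ, if_pos hi]
      exact mul_div_cancel₀ _ (hθpos i hi).ne'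
    · simp [hv, hξ, hi]
  have huξ : u ⬝ᵥ ξ = s := by
    simp [dotProduct, hξ, hs, pow_two]
  have hξξ : ξ ⬝ᵥ ξ = s := by
    simp [dotProduct, hξ, hs, pow_two]
  have hHtξ : Ht.mulVec ξ = ((β * b - α * (a / r)) * s) • u + (α * (a / r)) • ξ := by
    have hof : (Matrix.of (fun i j => x i * x j / r ^ 2) : Matrix (Fin N) (Fin N) ℝ)
        = Matrix.vecMulVec u u := by
      ext i j
      simp only [Matrix.of_apply, Matrix.vecMulVec_apply, hu]
      field_simp
    rw [hHt, hof, Matrix.add_mulVec, Matrix.smul_mulVec, Matrix.smul_mulVec,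
      Matrix.one_mulVec, Matrix.vecMulVec_mulVec, huξ]
    ext i
    simp
    ring
  have hquad : v ⬝ᵥ H.mulVec v = s * (β * b * s + α * (a / r) * (1 - s)) := by
    have h2 : Θ.transpose = Θ := by rw [hΘ]; simp
    rw [hH, ← Matrix.mulVec_mulVec, ← Matrix.mulVec_mulVec, hΘv, Matrix.dotProduct_mulVec,
      ← Matrix.mulVec_transpose, h2, hΘv, hHtξ, dotProduct_add, dotProduct_smul,
      dotProduct_smul, dotProduct_comm ξ u, huξ, hξξ]
    simp only [smul_eq_mul]
    ring
  have hq2 : v ⬝ᵥ H.mulVec v ≤ s * (b / 4) := by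
    rw [hquad]
    refine mul_le_mul_of_nonneg_left (le_trans ?_ hcond) hs0
    have hc : 0 < α * (a / r) := mul_pos (by linarith [hα.1]) (by positivity)
    have hβb : β * b ≤ 0 := mul_nonpos_of_nonneg_of_nonpos (by linarith [hβ.1]) hb.le
    nlinarith [mul_nonneg (sub_nonneg.mpr hs_ge) hc.le,
      mul_nonneg (sub_nonneg.mpr hs_ge) (neg_nonneg.mpr hβb)]
  refine exists_eigenvalue_le H hHsym _ v hvne (hq2.trans ?_)
  have hvv : 0 ≤ v ⬝ᵥ v := Finset.sum_nonneg fun i _ => mul_self_nonneg _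
  have hq0 : 0 ≤ K * (v ⬝ᵥ v) / I.card := by positivity
  have hq1 : K * (v ⬝ᵥ v) / I.card ≤ 1 := (div_le_one hn).mpr hD
  have hfin : (1 - N * r ^ (2 * ε)) * (K * (v ⬝ᵥ v) / I.card) ≤ s := by
    calc _ ≤ s * (K * (v ⬝ᵥ v) / I.card) := mul_le_mul_of_nonneg_right hs_ge hq0
      _ ≤ s := mul_le_of_le_one_right hs0 hq1
  have := mul_le_mul_of_nonpos_right hfin (by linarith : b / 4 ≤ 0)
  refine this.trans (le_of_eq ?_)
  rw [hK]
  ring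
end

section
/- Let p > 2, N ≥ 1 and M > 1. Let ω : [0,∞) → ℝ be continuous with ω(0) = 0, C² on (0,∞), with ω(s) > 0, ω′(s) > 0, ω″(s) < 0 for s ∈ (0,1). Fix x ∈ ℝᴺ with 0 < |x| < 1, set g(y) = ω(|y|), H₁(x) = D²g(x), ι = 1/(4M|H₁(x)|), and H̃(x) = H₁(x) + 2ι H₁(x)². Let Θ(x) be the diagonal N×N matrix with entries Θᵢᵢ = |ω′(|x|) xᵢ/|x||^{(p−2)/2}. Suppose the symmetric N×N matrices X, Y satisfy −6M|H₁(x)| I_{2N} ≤ diag(X − (2M+1)Id, Y − (2M+1)Id) ≤ M [[H̃(x), −H̃(x)], [−H̃(x), H̃(x)]] (as 2N×2N symmetric matrices). Then Θ(x)(X + Y − 2(2M+1)Id)Θ(x) ≤ 0 (negative semidefinite); consequently every eigenvalue λᵢ of M^{p−2} Θ(x)(X+Y)Θ(x) satisfies λᵢ ≤ 2(2M+1) M^{p−2} |Θ(x)|² ≤ 6 M^{p−1} |Θ(x)|². -/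
open Metric MeasureTheory Topology Filter Set

/-- **Proposition 3.2, part 1.** Under the matrix inequalities
`-6M|H₁| I ≤ diag(X - (2M+1)Id, Y - (2M+1)Id) ≤ M [[H̃, -H̃], [-H̃, H̃]]` (with `H₁ = D²g(x)`,
`g = ω(| · |)`, `ι = 1/(4M|H₁|)`, `H̃ = H₁ + 2ι H₁²`), one has
`Θ (X + Y - 2(2M+1) Id) Θ ≤ 0`; consequently every eigenvalue of `M^(p-2) Θ (X+Y) Θ` is at most
`2(2M+1) M^(p-2) |Θ|² ≤ 6 M^(p-1) |Θ|²`. -/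
theorem matrix_estimate_part_one (N : ℕ) (hN : 1 ≤ N) (p : ℝ) (hp : 2 < p)
    (M : ℝ) (hM : 1 < M)
    (ω : ℝ → ℝ) (hω_cont : ContinuousOn ω (Ici 0)) (hω0 : ω 0 = 0)
    (hω_smooth : ContDiffOn ℝ 2 ω (Ioi 0))
    (hω_pos : ∀ s ∈ Ioo (0 : ℝ) 1, 0 < ω s)
    (hω'_pos : ∀ s ∈ Ioo (0 : ℝ) 1, 0 < deriv ω s)
    (hω''_neg : ∀ s ∈ Ioo (0 : ℝ) 1, deriv (deriv ω) s < 0)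
    (x : EuclideanSpace ℝ (Fin N)) (hx : 0 < ‖x‖) (hx1 : ‖x‖ < 1)
    (H1 : Matrix (Fin N) (Fin N) ℝ)
    (hH1 : H1 = hess (fun y : EuclideanSpace ℝ (Fin N) => ω ‖y‖) x)
    (ι : ℝ) (hι : ι = 1 / (4 * M * symNorm H1))
    (Ht : Matrix (Fin N) (Fin N) ℝ) (hHt : Ht = H1 + (2 * ι) • H1 ^ 2)
    (Θ : Matrix (Fin N) (Fin N) ℝ)
    (hΘ : Θ = Matrix.diagonal fun i => |deriv ω ‖x‖ * x i / ‖x‖| ^ ((p - 2) / 2))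
    (X Y : Matrix (Fin N) (Fin N) ℝ) (hX : X.IsSymm) (hY : Y.IsSymm)
    (hlow : (Matrix.fromBlocks (X - (2 * M + 1) • 1) 0 0 (Y - (2 * M + 1) • 1) -
      (-(6 * M * symNorm H1)) • (1 : Matrix (Fin N ⊕ Fin N) (Fin N ⊕ Fin N) ℝ)).PosSemidef)
    (hup : (M • Matrix.fromBlocks Ht (-Ht) (-Ht) Ht -
      Matrix.fromBlocks (X - (2 * M + 1) • 1) 0 0 (Y - (2 * M + 1) • 1)).PosSemidef) :
    (-(Θ * (X + Y - (2 * (2 * M + 1)) • 1) * Θ)).PosSemidef ∧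
    (∀ (μ : ℝ) (v : Fin N → ℝ), v ≠ 0 →
      (M ^ (p - 2) • (Θ * (X + Y) * Θ)).mulVec v = μ • v →
      μ ≤ 2 * (2 * M + 1) * M ^ (p - 2) * symNorm Θ ^ 2) ∧
    2 * (2 * M + 1) * M ^ (p - 2) * symNorm Θ ^ 2 ≤ 6 * M ^ (p - 1) * symNorm Θ ^ 2 := by
  have key : (-(X + Y - (2 * (2 * M + 1)) • (1 : Matrix (Fin N) (Fin N) ℝ))).PosSemidef := by
    have h := hup.conjTranspose_mul_mul_same
      (Matrix.fromRows (1 : Matrix (Fin N) (Fin N) ℝ) (1 : Matrix (Fin N) (Fin N) ℝ))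
    convert h using 1
    rw [Matrix.conjTranspose_fromRows_eq_fromCols_conjTranspose, Matrix.fromBlocks_smul,
      sub_eq_add_neg (Matrix.fromBlocks _ _ _ _),
      Matrix.fromBlocks_neg, Matrix.fromBlocks_add, Matrix.fromCols_mul_fromBlocks,
      Matrix.fromCols_mul_fromRows]
    simp
    module
  have hΘT : Θ.conjTranspose = Θ := by
    rw [hΘ, Matrix.diagonal_conjTranspose]
    simp
  have h1 : (-(Θ * (X + Y - (2 * (2 * M + 1)) • 1) * Θ)).PosSemidef := by
    have h := key.conjTranspose_mul_mul_same Θ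
    rw [hΘT] at h
    rwa [Matrix.mul_neg, Matrix.neg_mul] at h
  have hMp : 0 < M ^ (p - 2) := Real.rpow_pos_of_pos (by linarith) _
  refine ⟨h1, ?_, ?_⟩
  · intro μ v hv hev
    set θ : Fin N → ℝ := fun i => |deriv ω ‖x‖ * x i / ‖x‖| ^ ((p - 2) / 2) with hθ
    have hθ0 : ∀ i, 0 ≤ θ i := fun i => by simp only [hθ]; positivity
    have hsum : ∀ w : Fin N → ℝ, ∑ i, ∑ j, w i * Θ i j * w j = ∑ i, θ i * w i ^ 2 := by
      intro w
      refine Finset.sum_congr rfl fun i _ => ?_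
      rw [Finset.sum_eq_single i]
      · rw [hΘ, Matrix.diagonal_apply_eq]; ring
      · intro j _ hj
        rw [hΘ, Matrix.diagonal_apply_ne _ hj.symm]; ring
      · simp
    have hb : BddAbove {r : ℝ | ∃ v : EuclideanSpace ℝ (Fin N), ‖v‖ = 1 ∧
        r = |∑ i, ∑ j, v i * Θ i j * v j|} := by
      refine ⟨∑ i, θ i, ?_⟩
      rintro r ⟨w, hw, rfl⟩
      rw [hsum, abs_of_nonneg (Finset.sum_nonneg fun i _ => mul_nonneg (hθ0 i) (sq_nonneg _))]
      refine Finset.sum_le_sum fun i _ => ?_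
      have h2 : |w i| ≤ 1 := by
        have := PiLp.norm_apply_le w i
        rw [hw] at this
        simpa using this
      have h3 : w i ^ 2 ≤ 1 := (sq_le_one_iff_abs_le_one _).2 h2
      nlinarith [hθ0 i]
    have hle : ∀ i, θ i ≤ symNorm Θ := by
      intro i
      refine le_csSup hb ⟨EuclideanSpace.single i 1, by simp, ?_⟩
      rw [hsum, Finset.sum_eq_single i]
      · simp [abs_of_nonneg (hθ0 i)]
      · intro j _ hj
        simp [hj]
      · simp
    have hvv : 0 < v ⬝ᵥ v := by
      have := Matrix.dotProduct_star_self_pos_iff.2 hv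
      simpa using this
    have hq := h1.dotProduct_mulVec_nonneg v
    have hΘv : v ⬝ᵥ (Θ * Θ).mulVec v ≤ symNorm Θ ^ 2 * (v ⬝ᵥ v) := by
      rw [hΘ, Matrix.diagonal_mul_diagonal]
      simp only [dotProduct, Matrix.mulVec_diagonal, Finset.mul_sum]
      rw [← hΘ]
      refine Finset.sum_le_sum fun i _ => ?_
      have : θ i * θ i ≤ symNorm Θ ^ 2 := by nlinarith [hθ0 i, hle i]
      nlinarith [mul_self_nonneg (v i)]
    have e1 : M ^ (p - 2) * (v ⬝ᵥ (Θ * (X + Y) * Θ).mulVec v) = μ * (v ⬝ᵥ v) := by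
      have := congrArg (fun w => v ⬝ᵥ w) hev
      simpa [Matrix.smul_mulVec, dotProduct_smul] using this
    have e2 : -(Θ * (X + Y - (2 * (2 * M + 1)) • (1 : Matrix (Fin N) (Fin N) ℝ)) * Θ)
        = (2 * (2 * M + 1)) • (Θ * Θ) - Θ * (X + Y) * Θ := by
      rw [mul_sub, sub_mul]
      simp
    rw [e2, Matrix.sub_mulVec, Matrix.smul_mulVec, dotProduct_sub, dotProduct_smul, star_trivial,
      smul_eq_mul] at hq
    have h5 : v ⬝ᵥ (Θ * (X + Y) * Θ).mulVec v ≤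
        2 * (2 * M + 1) * (symNorm Θ ^ 2 * (v ⬝ᵥ v)) := by
      have := mul_le_mul_of_nonneg_left hΘv (by linarith : (0:ℝ) ≤ 2 * (2 * M + 1))
      linarith
    refine le_of_mul_le_mul_right ?_ hvv
    rw [← e1]
    calc _ ≤ _ := mul_le_mul_of_nonneg_left h5 hMp.le
      _ = _ := by ring
  · have : M ^ (p - 1) = M ^ (p - 2) * M := by
      rw [← Real.rpow_add_one (by linarith)]
      congr 1
      ring
    rw [this]
    refine mul_le_mul_of_nonneg_right ?_ (sq_nonneg _)
    nlinarith
end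

section
/- Let 2 < p ≤ 4, N ≥ 1 and M > 1. Let ω : [0,∞) → ℝ be continuous with ω(0) = 0, C² on (0,∞), with ω(s) > 0, ω′(s) > 0, ω″(s) < 0 for s ∈ (0,1). Fix x ∈ ℝᴺ with 0 < |x| < 1, set g(y) = ω(|y|), H₁(x) = D²g(x), ι = 1/(4M|H₁(x)|), H̃(x) = H₁(x) + 2ι H₁(x)², and let Θ(x) be the diagonal N×N matrix with entries Θᵢᵢ = |ω′(|x|) xᵢ/|x||^{(p−2)/2}. Suppose the symmetric N×N matrices X, Y satisfy −6M|H₁(x)| I_{2N} ≤ diag(X − (2M+1)Id, Y − (2M+1)Id) ≤ M [[H̃(x), −H̃(x)], [−H̃(x), H̃(x)]]. Then the smallest eigenvalue λ₁ of M^{p−2} Θ(x)(X + Y − 2(2M+1)Id)Θ(x) satisfies λ₁ ≤ 2 M^{p−1} N^{(2−p)/2} (ω′(|x|))^{p−2} ω″(|x|). -/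
open Metric MeasureTheory Topology Filter Set

theorem aux_eig {n : Type*} [Fintype n] [DecidableEq n] (A : Matrix n n ℝ) (hA : A.IsSymm)
    (c : ℝ) (v : n → ℝ) (hv : v ≠ 0) (h : v ⬝ᵥ A.mulVec v ≤ c * (v ⬝ᵥ v)) :
    ∃ μ : ℝ, (∃ w : n → ℝ, w ≠ 0 ∧ A.mulVec w = μ • w) ∧ μ ≤ c := by
  have hB : (A - c • (1 : Matrix n n ℝ)).IsHermitian := by
    have h1 : A.IsHermitian := by
      rw [Matrix.IsHermitian, Matrix.conjTranspose_eq_transpose_of_trivial]; exact hA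
    have h2 : (c • (1 : Matrix n n ℝ)).IsHermitian := by
      rw [Matrix.IsHermitian, Matrix.conjTranspose_eq_transpose_of_trivial]; simp
    exact h1.sub h2
  have hn : ¬ (A - c • (1 : Matrix n n ℝ)).PosDef := by
    intro hp
    have := (Matrix.posDef_iff_dotProduct_mulVec.1 hp).2 hv
    simp [Matrix.sub_mulVec, Matrix.smul_mulVec, dotProduct_sub] at this
    linarith
  rw [hB.posDef_iff_eigenvalues_pos] at hn
  push Not at hn
  obtain ⟨i, hi⟩ := hn
  refine ⟨hB.eigenvalues i + c, ⟨(hB.eigenvectorBasis i).ofLp, ?_, ?_⟩, by linarith⟩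
  · intro h0
    have := hB.eigenvectorBasis.orthonormal.ne_zero i
    exact this (by ext j; simpa using congrFun h0 j)
  · have := hB.mulVec_eigenvectorBasis i
    rw [Matrix.sub_mulVec, Matrix.smul_mulVec, Matrix.one_mulVec, sub_eq_iff_eq_add] at this
    rw [this, add_smul]

theorem aux_symNorm {n : Type*} [Fintype n] (A : Matrix n n ℝ) (v : EuclideanSpace ℝ n)
    (hv : ‖v‖ = 1) : |∑ i, ∑ j, v i * A i j * v j| ≤ symNorm A := by
  refine le_csSup ⟨∑ i, ∑ j, |A i j|, ?_⟩ ⟨v, hv, rfl⟩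
  rintro r ⟨w, hw, rfl⟩
  refine (Finset.abs_sum_le_sum_abs _ _).trans (Finset.sum_le_sum fun i _ => ?_)
  refine (Finset.abs_sum_le_sum_abs _ _).trans (Finset.sum_le_sum fun j _ => ?_)
  have hi : ∀ i, |w i| ≤ 1 := fun i => by
    have := PiLp.norm_apply_le w i
    rw [hw] at this; simpa using this
  rw [abs_mul, abs_mul]
  calc |w i| * |A i j| * |w j| ≤ 1 * |A i j| * 1 := by
        gcongr
        · exact hi i
        · exact hi j
    _ = _ := by ring

theorem aux_norm {E : Type*} [NormedAddCommGroup E] [InnerProductSpace ℝ E] (y : E) (hy : y ≠ 0) :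
    HasFDerivAt (fun z : E => ‖z‖) ((‖y‖)⁻¹ • innerSL ℝ y) y := by
  have h := (hasStrictFDerivAt_norm_sq y).hasFDerivAt.sqrt (by positivity)
  simp only [Real.sqrt_sq (norm_nonneg _)] at h
  convert h using 1
  ext u
  have : ‖y‖ ≠ 0 := by positivity
  simp
  field_simp

theorem aux_hess {E : Type*} [NormedAddCommGroup E] [InnerProductSpace ℝ E] (ω : ℝ → ℝ)
    (hω : ContDiffOn ℝ 2 ω (Ioi 0)) (x : E) (hx : 0 < ‖x‖) (u : E) :
    fderiv ℝ (fderiv ℝ (fun y : E => ω ‖y‖)) x u x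
      = deriv (deriv ω) ‖x‖ * inner ℝ x u := by
  have h1 : ∀ y : E, y ≠ 0 → fderiv ℝ (fun y : E => ω ‖y‖) y
      = (deriv ω ‖y‖ * ‖y‖⁻¹) • innerSL ℝ y := by
    intro y hy
    have hd : DifferentiableAt ℝ ω ‖y‖ :=
      (hω.contDiffAt (Ioi_mem_nhds (by positivity))).differentiableAt (by norm_num)
    have := hd.hasDerivAt.comp_hasFDerivAt y (aux_norm y hy)
    rw [mul_smul]
    exact this.fderiv
  have hx0 : x ≠ 0 := norm_pos_iff.1 hx
  have h2 : fderiv ℝ (fun y : E => ω ‖y‖) =ᶠ[𝓝 x]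
      fun y => (deriv ω ‖y‖ * ‖y‖⁻¹) • innerSL ℝ y := by
    filter_upwards [isOpen_ne.mem_nhds hx0] with y hy using h1 y hy
  rw [h2.fderiv_eq]
  have hd2 : DifferentiableAt ℝ (deriv ω) ‖x‖ := by
    have : ContDiffOn ℝ 1 (deriv ω) (Ioi 0) :=
      ((contDiffOn_succ_iff_deriv_of_isOpen (n := 1) isOpen_Ioi).1
        (by simpa [one_add_one_eq_two] using hω)).2.2
    exact (this.contDiffAt (Ioi_mem_nhds hx)).differentiableAt (by norm_num)
  have hc := (hd2.hasDerivAt.mul (hasDerivAt_inv hx.ne')).comp_hasFDerivAt x (aux_norm x hx0)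
  have hs := hc.smul (innerSL ℝ (E := E)).hasFDerivAt
  have hs' := hs.fderiv
  have hs'' : fderiv ℝ (fun y : E => (deriv ω ‖y‖ * ‖y‖⁻¹) • innerSL ℝ y) x = _ := hs'
  rw [hs'']
  change (deriv ω ‖x‖ * ‖x‖⁻¹) * inner ℝ u x + ((deriv (deriv ω) ‖x‖ * ‖x‖⁻¹ +
    deriv ω ‖x‖ * -(‖x‖ ^ 2)⁻¹) * (‖x‖⁻¹ * inner ℝ x u)) * inner ℝ x x = _
  rw [real_inner_self_eq_norm_sq, real_inner_comm x u]
  field_simp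
  ring

theorem aux_pow {N : ℕ} (hN : 1 ≤ N) (q : ℝ) (hq0 : 0 ≤ q) (hq1 : q ≤ 1) (z : Fin N → ℝ)
    (hz : ∀ i, 0 ≤ z i) (hs : ∑ i, z i = 1) : ∑ i, z i ^ q ≤ (N : ℝ) ^ (1 - q) := by
  have hN' : (0 : ℝ) < N := by exact_mod_cast hN
  have := (Real.concaveOn_rpow hq0 hq1).le_map_sum (t := Finset.univ) (w := fun _ : Fin N => (N:ℝ)⁻¹)
    (p := z) (fun _ _ => by positivity) (by simp [hN'.ne']) (fun i _ => hz i)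
  simp only [smul_eq_mul, ← Finset.mul_sum, hs, mul_one] at this
  rw [Real.inv_rpow hN'.le, inv_mul_le_iff₀ hN'] at this
  rwa [Real.rpow_sub hN', Real.rpow_one, div_eq_mul_inv]

theorem aux_block {n : Type*} [Fintype n] [DecidableEq n] (P Q R : Matrix n n ℝ)
    (h : (Matrix.fromBlocks P (-P) (-P) P - Matrix.fromBlocks Q 0 0 R).PosSemidef) (e : n → ℝ) :
    e ⬝ᵥ (Q + R).mulVec e ≤ 4 * (e ⬝ᵥ P.mulVec e) := by
  have := h.dotProduct_mulVec_nonneg (Sum.elim e (-e))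
  simp [Matrix.sub_mulVec, Matrix.fromBlocks_mulVec, dotProduct_sub,
    Matrix.mulVec_neg, Matrix.neg_mulVec, Matrix.add_mulVec] at this ⊢
  linarith

/-- **Proposition 3.2, part 2, case `2 < p ≤ 4`.** Under the same matrix inequalities, the
smallest eigenvalue `λ₁` of `M^(p-2) Θ (X + Y - 2(2M+1) Id) Θ` satisfies
`λ₁ ≤ 2 M^(p-1) N^((2-p)/2) (ω'(|x|))^(p-2) ω''(|x|)` (stated as: there is an eigenvalue with
this bound). -/
theorem matrix_estimate_part_two_p_le_four (N : ℕ) (hN : 1 ≤ N) (p : ℝ)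
    (hp : 2 < p) (hp4 : p ≤ 4)
    (M : ℝ) (hM : 1 < M)
    (ω : ℝ → ℝ) (hω_cont : ContinuousOn ω (Ici 0)) (hω0 : ω 0 = 0)
    (hω_smooth : ContDiffOn ℝ 2 ω (Ioi 0))
    (hω_pos : ∀ s ∈ Ioo (0 : ℝ) 1, 0 < ω s)
    (hω'_pos : ∀ s ∈ Ioo (0 : ℝ) 1, 0 < deriv ω s)
    (hω''_neg : ∀ s ∈ Ioo (0 : ℝ) 1, deriv (deriv ω) s < 0)
    (x : EuclideanSpace ℝ (Fin N)) (hx : 0 < ‖x‖) (hx1 : ‖x‖ < 1)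
    (H1 : Matrix (Fin N) (Fin N) ℝ)
    (hH1 : H1 = hess (fun y : EuclideanSpace ℝ (Fin N) => ω ‖y‖) x)
    (ι : ℝ) (hι : ι = 1 / (4 * M * symNorm H1))
    (Ht : Matrix (Fin N) (Fin N) ℝ) (hHt : Ht = H1 + (2 * ι) • H1 ^ 2)
    (Θ : Matrix (Fin N) (Fin N) ℝ)
    (hΘ : Θ = Matrix.diagonal fun i => |deriv ω ‖x‖ * x i / ‖x‖| ^ ((p - 2) / 2))
    (X Y : Matrix (Fin N) (Fin N) ℝ) (hX : X.IsSymm) (hY : Y.IsSymm)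
    (hlow : (Matrix.fromBlocks (X - (2 * M + 1) • 1) 0 0 (Y - (2 * M + 1) • 1) -
      (-(6 * M * symNorm H1)) • (1 : Matrix (Fin N ⊕ Fin N) (Fin N ⊕ Fin N) ℝ)).PosSemidef)
    (hup : (M • Matrix.fromBlocks Ht (-Ht) (-Ht) Ht -
      Matrix.fromBlocks (X - (2 * M + 1) • 1) 0 0 (Y - (2 * M + 1) • 1)).PosSemidef) :
    ∃ μ : ℝ, (∃ v : Fin N → ℝ, v ≠ 0 ∧
        (M ^ (p - 2) • (Θ * (X + Y - (2 * (2 * M + 1)) • 1) * Θ)).mulVec v = μ • v) ∧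
      μ ≤ 2 * M ^ (p - 1) * (N : ℝ) ^ ((2 - p) / 2) *
        deriv ω ‖x‖ ^ (p - 2) * deriv (deriv ω) ‖x‖ := by
  have hNpos : (0 : ℝ) < N := by exact_mod_cast hN
  set r := ‖x‖ with hr
  set a := deriv ω r with ha
  set b := deriv (deriv ω) r with hb
  have ha0 : 0 < a := hω'_pos r ⟨hx, hx1⟩
  have hb0 : b < 0 := hω''_neg r ⟨hx, hx1⟩
  -- the unit vector
  set e : Fin N → ℝ := fun i => x i / r with he
  have hee : ∑ i, e i ^ 2 = 1 := by
    have : ∑ i, x i ^ 2 = r ^ 2 := by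
      rw [hr, EuclideanSpace.norm_sq_eq]; simp
    simp only [he, div_pow, ← Finset.sum_div, this]
    field_simp
  have heed : e ⬝ᵥ e = 1 := by
    rw [← hee]; simp [dotProduct, sq]
  have hHe : H1.mulVec e = b • e := by
    ext i
    have hxs : x = ∑ j, x j • EuclideanSpace.single j (1 : ℝ) := by
      ext k; simp [Pi.single_apply]
    have h1 := aux_hess ω hω_smooth x hx (EuclideanSpace.single i 1)
    have h2 : H1.mulVec e i = (fderiv ℝ (fderiv ℝ (fun y : EuclideanSpace ℝ (Fin N) => ω ‖y‖)) x
        (EuclideanSpace.single i 1) x) / r := by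
      conv_rhs => enter [1, 2]; rw [hxs]
      rw [hH1]
      simp only [Matrix.mulVec, dotProduct, hess, Matrix.of_apply, iteratedFDeriv_two_apply,
        map_sum, map_smul, smul_eq_mul, Finset.sum_div, he]
      refine Finset.sum_congr rfl fun j _ => ?_
      simp
      ring
    rw [h2, h1]
    simp [he, EuclideanSpace.inner_single_right]
    ring
  have hsn : -b ≤ symNorm H1 := by
    have hn : ‖(WithLp.toLp 2 e : EuclideanSpace ℝ (Fin N))‖ = 1 := by
      rw [EuclideanSpace.norm_eq]; simp [hee]
    have h1 := aux_symNorm H1 (WithLp.toLp 2 e) hn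
    have h2 : ∑ i, ∑ j, e i * H1 i j * e j = b := by
      have : e ⬝ᵥ H1.mulVec e = b := by rw [hHe]; simp [heed]
      rw [← this]
      simp [dotProduct, Matrix.mulVec, Finset.mul_sum, mul_assoc]
    simp only [h2] at h1
    rwa [abs_of_neg hb0] at h1
  have hsp : 0 < symNorm H1 := by linarith
  have hHte : e ⬝ᵥ Ht.mulVec e ≤ b / 2 := by
    have h1 : e ⬝ᵥ Ht.mulVec e = b + 2 * ι * b ^ 2 := by
      rw [hHt, Matrix.add_mulVec, Matrix.smul_mulVec, sq, ← Matrix.mulVec_mulVec, hHe,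
        Matrix.mulVec_smul, hHe]
      simp only [dotProduct_add, dotProduct_smul, smul_eq_mul, heed]
      ring
    rw [h1]
    have h2 : 4 * ι * (-b) ≤ 1 := by
      rw [hι]
      have : 4 * (1 / (4 * M * symNorm H1)) * (-b) = (-b) / (M * symNorm H1) := by field_simp
      rw [this, div_le_one (by positivity)]
      nlinarith
    nlinarith
  set S := X + Y - (2 * (2 * M + 1)) • (1 : Matrix (Fin N) (Fin N) ℝ) with hS
  have hSe : e ⬝ᵥ S.mulVec e ≤ 2 * M * b := by
    have h1 := aux_block (M • Ht) (X - (2 * M + 1) • 1) (Y - (2 * M + 1) • 1)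
      (by rw [Matrix.fromBlocks_smul] at hup; simpa using hup) e
    have h2 : X - (2 * M + 1) • 1 + (Y - (2 * M + 1) • 1) = S := by
      rw [hS]; module
    rw [h2, Matrix.smul_mulVec, dotProduct_smul, smul_eq_mul] at h1
    nlinarith
  have hSsymm : S.IsSymm := by
    simp [Matrix.IsSymm, hS, hX.eq, hY.eq]
  -- the test vector
  set q := (4 - p) / 2 with hq
  set v : Fin N → ℝ := fun i => SignType.sign (e i) * |e i| ^ q with hv
  have hvv : v ⬝ᵥ v ≤ (N : ℝ) ^ ((p - 2) / 2) := by
    have h1 := aux_pow hN q (by rw [hq]; linarith) (by rw [hq]; linarith) (fun i => e i ^ 2)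
      (fun i => sq_nonneg _) hee
    rw [show 1 - q = (p - 2) / 2 by rw [hq]; ring] at h1
    refine le_trans (Finset.sum_le_sum fun i _ => ?_) h1
    have h3 : (e i ^ 2) ^ q = |e i| ^ q * |e i| ^ q := by
      rw [← sq_abs, sq, Real.mul_rpow (abs_nonneg _) (abs_nonneg _)]
    simp only [hv, h3]
    rcases lt_trichotomy (e i) 0 with h | h | h
    · simp [h]
    · simp [h]; positivity
    · simp [h]
  have hΘv : Θ.mulVec v = a ^ ((p - 2) / 2) • e := by
    ext i
    rw [hΘ, Matrix.mulVec_diagonal]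
    have h1 : |a * x i / r| = a * |e i| := by
      rw [mul_div_assoc, abs_mul, abs_of_pos ha0]
    rw [h1, Real.mul_rpow ha0.le (abs_nonneg _)]
    simp only [hv, Pi.smul_apply, smul_eq_mul]
    rcases eq_or_ne (e i) 0 with h | h
    · simp [h]
    · have h2 : |e i| ^ ((p - 2) / 2) * |e i| ^ q = |e i| := by
        rw [← Real.rpow_add (abs_pos.2 h), show (p - 2) / 2 + q = 1 by rw [hq]; ring, Real.rpow_one]
      calc _ = a ^ ((p - 2) / 2) * (SignType.sign (e i) * (|e i| ^ ((p - 2) / 2) * |e i| ^ q)) := by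
            ring
        _ = _ := by rw [h2, sign_mul_abs]
  have hv0 : v ≠ 0 := by
    intro h0
    rw [h0, Matrix.mulVec_zero] at hΘv
    have : e = 0 := by
      have h3 : a ^ ((p - 2) / 2) ≠ 0 := by positivity
      exact (smul_eq_zero.1 hΘv.symm).resolve_left h3
    simp [this] at heed
  have hΘs : Θ.transpose = Θ := by rw [hΘ]; simp
  refine aux_eig _ ?_ _ v hv0 ?_
  · simp [Matrix.IsSymm, hΘs, hSsymm.eq, Matrix.mul_assoc]
  · have hM0 : 0 < M := by linarith
    have h1 : v ⬝ᵥ (M ^ (p - 2) • (Θ * S * Θ)).mulVec v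
        = M ^ (p - 2) * (a ^ (p - 2) * (e ⬝ᵥ S.mulVec e)) := by
      rw [Matrix.smul_mulVec, dotProduct_smul, ← Matrix.mulVec_mulVec, ← Matrix.mulVec_mulVec,
        Matrix.dotProduct_mulVec, ← Matrix.mulVec_transpose, hΘs, hΘv, Matrix.mulVec_smul]
      have : a ^ (p - 2) = a ^ ((p - 2) / 2) * a ^ ((p - 2) / 2) := by
        rw [← Real.rpow_add ha0]; congr 1; ring
      simp only [this, smul_dotProduct, dotProduct_smul, smul_eq_mul]
      ring
    rw [h1]
    have h2 : M ^ (p - 1) = M ^ (p - 2) * M := by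
      rw [← Real.rpow_add_one hM0.ne']; congr 1; ring
    have h3 : (N : ℝ) ^ ((2 - p) / 2) * (v ⬝ᵥ v) ≤ 1 := by
      rw [show (2 - p) / 2 = -((p - 2) / 2) by ring, Real.rpow_neg hNpos.le,
        inv_mul_le_iff₀ (by positivity)]
      simpa using hvv
    have hK : 0 < M ^ (p - 2) * a ^ (p - 2) := by positivity
    calc _ = M ^ (p - 2) * a ^ (p - 2) * (e ⬝ᵥ S.mulVec e) := by ring
      _ ≤ M ^ (p - 2) * a ^ (p - 2) * (2 * M * b) := by gcongr
      _ ≤ M ^ (p - 2) * a ^ (p - 2) * (2 * M * b) * ((N : ℝ) ^ ((2 - p) / 2) * (v ⬝ᵥ v)) := by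
          have : M ^ (p - 2) * a ^ (p - 2) * (2 * M * b) ≤ 0 :=
            mul_nonpos_of_nonneg_of_nonpos hK.le (by nlinarith)
          nlinarith
      _ = _ := by rw [h2]; ring
end

section
/- Let p ≥ 4, N ≥ 1 and M > 1. Let ω : [0,∞) → ℝ be continuous with ω(0) = 0, C² on (0,∞), with ω(s) > 0, ω′(s) > 0, ω″(s) < 0 for s ∈ (0,1). Fix x ∈ ℝᴺ with 0 < |x| < 1, set g(y) = ω(|y|), H₁(x) = D²g(x), ι = 1/(4M|H₁(x)|), H̃(x) = H₁(x) + 2ι H₁(x)², and write H̃(x) = (β ω″(|x|) − α ω′(|x|)/|x|)(x⊗x)/|x|² + α(ω′(|x|)/|x|) Id with α ∈ (1/2,3/2], β ∈ [1/2,3/2]. Let ε > 0 be such that I(x,ε) = { i : |xᵢ| ≥ |x|^{1+ε} } is nonempty and β ω″(|x|)(1 − N|x|^{2ε}) + α N |x|^{2ε} ω′(|x|)/|x| ≤ ω″(|x|)/4 < 0. Let Θ(x) be the diagonal matrix with entries Θᵢᵢ = |ω′(|x|) xᵢ/|x||^{(p−2)/2}. Suppose the symmetric N×N matrices X, Y satisfy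 −6M|H₁(x)| I_{2N} ≤ diag(X − (2M+1)Id, Y − (2M+1)Id) ≤ M [[H̃(x), −H̃(x)], [−H̃(x), H̃(x)]]. Then the smallest eigenvalue λ₁ of M^{p−2} Θ(x)(X + Y − 2(2M+1)Id)Θ(x) satisfies λ₁ ≤ M^{p−1} ((1 − N|x|^{2ε})/#I(x,ε)) (ω′(|x|))^{p−2} |x|^{(p−4)ε} ω″(|x|). -/
open Metric MeasureTheory Topology Filter Set

/-- A symmetric matrix with a small Rayleigh quotient has a small eigenvalue. -/
lemma exists_eig_le {N : ℕ} (A : Matrix (Fin N) (Fin N) ℝ) (hA : A.IsSymm) (c : ℝ)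
    (v : Fin N → ℝ) (hv : v ≠ 0) (h : v ⬝ᵥ A.mulVec v ≤ c * (v ⬝ᵥ v)) :
    ∃ μ : ℝ, (∃ u : Fin N → ℝ, u ≠ 0 ∧ A.mulVec u = μ • u) ∧ μ ≤ c := by
  have hH : (A - c • 1).IsHermitian := by
    unfold Matrix.IsHermitian
    rw [Matrix.conjTranspose_eq_transpose_of_trivial, Matrix.transpose_sub, hA.eq]
    simp
  have hnp : ¬ (A - c • 1).PosDef := by
    intro hp
    have := hp.dotProduct_mulVec_pos hv
    simp [Matrix.sub_mulVec, Matrix.smul_mulVec, dotProduct_sub] at this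
    linarith
  rw [hH.posDef_iff_eigenvalues_pos] at hnp
  push Not at hnp
  obtain ⟨i, hi⟩ := hnp
  refine ⟨hH.eigenvalues i + c, ⟨hH.eigenvectorBasis i, ?_, ?_⟩, by linarith⟩
  · intro h0
    apply hH.eigenvectorBasis.orthonormal.ne_zero i
    ext j
    exact congrFun h0 j
  · have := hH.mulVec_eigenvectorBasis i
    rw [Matrix.sub_mulVec, Matrix.smul_mulVec, Matrix.one_mulVec] at this
    rw [add_smul, ← this]
    simp

lemma block_quad_le {N : ℕ} (H A B : Matrix (Fin N) (Fin N) ℝ) (M : ℝ)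
    (h : (M • Matrix.fromBlocks H (-H) (-H) H - Matrix.fromBlocks A 0 0 B).PosSemidef)
    (ξ : Fin N → ℝ) :
    ξ ⬝ᵥ (A + B).mulVec ξ ≤ 4 * M * (ξ ⬝ᵥ H.mulVec ξ) := by
  have := h.dotProduct_mulVec_nonneg (Sum.elim ξ (-ξ))
  have hs : star (Sum.elim ξ (-ξ)) = Sum.elim ξ (-ξ) := by ext i; simp
  rw [hs, Matrix.sub_mulVec, Matrix.smul_mulVec, Matrix.fromBlocks_mulVec,
    Matrix.fromBlocks_mulVec, dotProduct_sub, dotProduct_smul] at this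
  simp [Matrix.mulVec_neg, Matrix.neg_mulVec] at this
  rw [Matrix.add_mulVec, dotProduct_add]
  linarith

lemma quad_form {N : ℕ} (x ξ : Fin N → ℝ) (r k l : ℝ) :
    ξ ⬝ᵥ (k • Matrix.of (fun i j => x i * x j / r ^ 2) +
      l • (1 : Matrix (Fin N) (Fin N) ℝ)).mulVec ξ =
      k * (∑ i, ξ i * (x i / r)) ^ 2 + l * ∑ i, ξ i ^ 2 := by
  rw [Matrix.add_mulVec, Matrix.smul_mulVec, Matrix.smul_mulVec, Matrix.one_mulVec,
    dotProduct_add, dotProduct_smul, dotProduct_smul, smul_eq_mul, smul_eq_mul]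
  congr 2
  · rw [sq (∑ i, ξ i * (x i / r)), Finset.sum_mul_sum]
    simp only [dotProduct, Matrix.mulVec, Matrix.of_apply, Finset.mul_sum]
    refine Finset.sum_congr rfl fun i _ => Finset.sum_congr rfl fun j _ => ?_
    ring
  · simp [dotProduct, sq]

lemma weight_bound {a w ρ p θ : ℝ} (ha : 0 < a) (hρ : 0 < ρ) (hw : ρ ≤ w) (hp : 4 ≤ p)
    (hθ : θ = (a * w) ^ ((p - 2) / 2)) :
    (w / θ) ^ 2 * (a ^ (p - 2) * ρ ^ (p - 4)) ≤ 1 := by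
  have hw0 : 0 < w := lt_of_lt_of_le hρ hw
  have h1 : θ ^ 2 = a ^ (p - 2) * w ^ (p - 4) * w ^ 2 := by
    rw [hθ, ← Real.rpow_natCast, ← Real.rpow_mul (by positivity), Real.mul_rpow ha.le hw0.le,
      ← Real.rpow_natCast w 2, mul_assoc, ← Real.rpow_add hw0]
    push_cast
    congr 2 <;> ring
  have h2 : ρ ^ (p - 4) ≤ w ^ (p - 4) := Real.rpow_le_rpow hρ.le hw (by linarith)
  rw [div_pow, h1, div_mul_eq_mul_div, div_le_one (by positivity)]
  have : 0 < a ^ (p - 2) * w ^ 2 := by positivity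
  nlinarith

set_option maxHeartbeats 2000000 in
/-- **Proposition 3.2, part 2, case `p ≥ 4`.** Under the same matrix inequalities and the
condition `β ω''(|x|)(1 - N|x|^(2ε)) + α N |x|^(2ε) ω'(|x|)/|x| ≤ ω''(|x|)/4 < 0` with
`I(x,ε) = {i : |xᵢ| ≥ |x|^(1+ε)}` nonempty, the smallest eigenvalue `λ₁` of
`M^(p-2) Θ (X + Y - 2(2M+1) Id) Θ` satisfies
`λ₁ ≤ M^(p-1) ((1 - N|x|^(2ε))/#I(x,ε)) (ω'(|x|))^(p-2) |x|^((p-4)ε) ω''(|x|)`. -/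
theorem matrix_estimate_part_two_p_ge_four (N : ℕ) (hN : 1 ≤ N) (p : ℝ) (hp : 4 ≤ p)
    (M : ℝ) (hM : 1 < M)
    (ω : ℝ → ℝ) (hω_cont : ContinuousOn ω (Ici 0)) (hω0 : ω 0 = 0)
    (hω_smooth : ContDiffOn ℝ 2 ω (Ioi 0))
    (hω_pos : ∀ s ∈ Ioo (0 : ℝ) 1, 0 < ω s)
    (hω'_pos : ∀ s ∈ Ioo (0 : ℝ) 1, 0 < deriv ω s)
    (hω''_neg : ∀ s ∈ Ioo (0 : ℝ) 1, deriv (deriv ω) s < 0)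
    (x : EuclideanSpace ℝ (Fin N)) (hx : 0 < ‖x‖) (hx1 : ‖x‖ < 1)
    (H1 : Matrix (Fin N) (Fin N) ℝ)
    (hH1 : H1 = hess (fun y : EuclideanSpace ℝ (Fin N) => ω ‖y‖) x)
    (ι : ℝ) (hι : ι = 1 / (4 * M * symNorm H1))
    (Ht : Matrix (Fin N) (Fin N) ℝ) (hHt : Ht = H1 + (2 * ι) • H1 ^ 2)
    (α β : ℝ) (hα : α ∈ Ioc (1/2 : ℝ) (3/2)) (hβ : β ∈ Icc (1/2 : ℝ) (3/2))
    (hαβ : Ht = (β * deriv (deriv ω) ‖x‖ - α * (deriv ω ‖x‖ / ‖x‖)) •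
        Matrix.of (fun i j => x i * x j / ‖x‖ ^ 2) +
      (α * (deriv ω ‖x‖ / ‖x‖)) • (1 : Matrix (Fin N) (Fin N) ℝ))
    (ε : ℝ) (hε : 0 < ε)
    (hInonempty : (Finset.univ.filter fun i : Fin N => ‖x‖ ^ (1 + ε) ≤ |x i|).Nonempty)
    (hcond : β * deriv (deriv ω) ‖x‖ * (1 - N * ‖x‖ ^ (2 * ε)) +
        α * N * ‖x‖ ^ (2 * ε) * (deriv ω ‖x‖ / ‖x‖) ≤ deriv (deriv ω) ‖x‖ / 4)
    (hcond' : deriv (deriv ω) ‖x‖ / 4 < 0)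
    (Θ : Matrix (Fin N) (Fin N) ℝ)
    (hΘ : Θ = Matrix.diagonal fun i => |deriv ω ‖x‖ * x i / ‖x‖| ^ ((p - 2) / 2))
    (X Y : Matrix (Fin N) (Fin N) ℝ) (hX : X.IsSymm) (hY : Y.IsSymm)
    (hlow : (Matrix.fromBlocks (X - (2 * M + 1) • 1) 0 0 (Y - (2 * M + 1) • 1) -
      (-(6 * M * symNorm H1)) • (1 : Matrix (Fin N ⊕ Fin N) (Fin N ⊕ Fin N) ℝ)).PosSemidef)
    (hup : (M • Matrix.fromBlocks Ht (-Ht) (-Ht) Ht -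
      Matrix.fromBlocks (X - (2 * M + 1) • 1) 0 0 (Y - (2 * M + 1) • 1)).PosSemidef) :
    ∃ μ : ℝ, (∃ v : Fin N → ℝ, v ≠ 0 ∧
        (M ^ (p - 2) • (Θ * (X + Y - (2 * (2 * M + 1)) • 1) * Θ)).mulVec v = μ • v) ∧
      μ ≤ M ^ (p - 1) * ((1 - N * ‖x‖ ^ (2 * ε)) /
          (Finset.univ.filter fun i : Fin N => ‖x‖ ^ (1 + ε) ≤ |x i|).card) *
        deriv ω ‖x‖ ^ (p - 2) * ‖x‖ ^ ((p - 4) * ε) * deriv (deriv ω) ‖x‖ := by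
  obtain ⟨hα1, hα2⟩ := hα
  obtain ⟨hβ1, hβ2⟩ := hβ
  have ha : 0 < deriv ω ‖x‖ := hω'_pos _ ⟨hx, hx1⟩
  have hb : deriv (deriv ω) ‖x‖ < 0 := hω''_neg _ ⟨hx, hx1⟩
  clear hω''_neg hω'_pos hω_pos hω_smooth hω0 hω_cont hlow hHt hι hH1
  have hrN : ∑ i, (x i) ^ 2 = ‖x‖ ^ 2 := by
    rw [EuclideanSpace.norm_sq_eq]; simp
  generalize deriv (deriv ω) ‖x‖ = b at *
  generalize deriv ω ‖x‖ = a at *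
  generalize ‖x‖ = r at *
  set I := Finset.univ.filter fun i : Fin N => r ^ (1 + ε) ≤ |x i| with hI
  have hn : (0 : ℝ) < I.card := by exact_mod_cast hInonempty.card_pos
  have hMI : ∀ i, i ∈ I ↔ r ^ (1 + ε) ≤ |x i| := by intro i; simp [hI]
  set θ : Fin N → ℝ := fun i => |a * x i / r| ^ ((p - 2) / 2) with hθ
  set ξ : Fin N → ℝ := fun i => if i ∈ I then x i / r else 0 with hξ
  set v : Fin N → ℝ := fun i => ξ i / θ i with hv
  have hrε : 0 < r ^ ε := Real.rpow_pos_of_pos hx _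
  have hw : ∀ i ∈ I, r ^ ε ≤ |x i| / r := by
    intro i hi
    rw [le_div_iff₀ hx]
    have := (hMI i).1 hi
    rw [Real.rpow_add hx, Real.rpow_one] at this
    linarith
  have hθw : ∀ i, θ i = (a * (|x i| / r)) ^ ((p - 2) / 2) := by
    intro i
    simp only [hθ]
    rw [abs_div, abs_mul, abs_of_pos ha, abs_of_pos hx, mul_div_assoc]
  have hθpos : ∀ i ∈ I, 0 < θ i := by
    intro i hi
    rw [hθw]
    have := lt_of_lt_of_le hrε (hw i hi)
    positivity
  have hΘv : Θ.mulVec v = ξ := by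
    ext i
    rw [hΘ, Matrix.mulVec_diagonal]
    by_cases hi : i ∈ I
    · have := (hθpos i hi).ne'
      change θ i * (ξ i / θ i) = ξ i
      field_simp
    · simp [hv, hξ, hi]
  have hvne : v ≠ 0 := by
    obtain ⟨i, hi⟩ := hInonempty
    intro h0
    have h1 := congrFun h0 i
    have h2 := hθpos i hi
    have h3 := lt_of_lt_of_le hrε (hw i hi)
    have h4 : x i ≠ 0 := by
      intro h; rw [h] at h3; simp at h3
    simp [hv, hξ, hi, h2.ne', hx.ne', h4] at h1
  set S : ℝ := ∑ i, ξ i ^ 2 with hS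
  have hS0 : 0 ≤ S := Finset.sum_nonneg fun i _ => sq_nonneg _
  have hS' : ∑ i, ξ i * (x i / r) = S := by
    refine Finset.sum_congr rfl fun i _ => ?_
    by_cases hi : i ∈ I <;> simp [hξ, hi, sq]
  have hone : ∑ i, (x i / r) ^ 2 = 1 := by
    simp only [div_pow]
    rw [← Finset.sum_div, hrN, div_self (by positivity)]
  have hST : 1 - N * r ^ (2 * ε) ≤ S := by
    have h1 : 1 - S ≤ ∑ i : Fin N, r ^ (2 * ε) := by
      rw [← hone, hS, ← Finset.sum_sub_distrib]
      refine Finset.sum_le_sum fun i _ => ?_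
      by_cases hi : i ∈ I
      · simp only [hξ, hi, if_true, sub_self]; positivity
      · simp only [hξ, hi, if_false]
        have h2 : |x i| / r ≤ r ^ ε := by
          rw [div_le_iff₀ hx]
          have := (hMI i).not.1 hi
          rw [Real.rpow_add hx, Real.rpow_one] at this
          linarith
        have h3 : r ^ (2 * ε) = (r ^ ε) ^ 2 := by
          rw [← Real.rpow_natCast, ← Real.rpow_mul hx.le]; push_cast; ring_nf
        rw [h3, ← sq_abs (x i / r), abs_div, abs_of_pos hx]
        have : 0 ≤ |x i| / r := by positivity
        nlinarith
    simp at h1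
    linarith
  have hq : ξ ⬝ᵥ Ht.mulVec ξ ≤ S * (b / 4) := by
    rw [hαβ, quad_form (fun i => x i) ξ r, hS', ← hS]
    have har : 0 < α * (a / r) := by have := div_pos ha hx; nlinarith
    have h1 : β * b * S + α * (a / r) * (1 - S) ≤ b / 4 := by
      refine le_trans ?_ hcond
      have h2 : β * b ≤ 0 := by nlinarith
      nlinarith
    nlinarith
  have hK := block_quad_le Ht _ _ M hup ξ
  have hKe : X - (2 * M + 1) • (1 : Matrix (Fin N) (Fin N) ℝ) + (Y - (2 * M + 1) • 1) =
      X + Y - (2 * (2 * M + 1)) • 1 := by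
    rw [mul_smul, two_smul]; abel
  rw [hKe] at hK
  set K := X + Y - (2 * (2 * M + 1)) • (1 : Matrix (Fin N) (Fin N) ℝ) with hKdef
  have hKsymm : K.IsSymm := by
    rw [hKdef, Matrix.IsSymm, Matrix.transpose_sub, Matrix.transpose_add, hX.eq, hY.eq]
    simp
  have hΘs : Θ.transpose = Θ := by rw [hΘ]; exact Matrix.diagonal_transpose _
  have hKb : ξ ⬝ᵥ K.mulVec ξ ≤ M * S * b := by nlinarith
  have hAs : (M ^ (p - 2) • (Θ * K * Θ)).IsSymm := by
    rw [Matrix.IsSymm, Matrix.transpose_smul, Matrix.transpose_mul, Matrix.transpose_mul,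
      hΘs, hKsymm.eq, Matrix.mul_assoc]
  have hMp : 0 < M ^ (p - 2) := Real.rpow_pos_of_pos (by linarith) _
  have hMp1 : M ^ (p - 1) = M ^ (p - 2) * M := by
    rw [← Real.rpow_add_one (by linarith)]; congr 1; ring
  have hquad : v ⬝ᵥ (M ^ (p - 2) • (Θ * K * Θ)).mulVec v = M ^ (p - 2) * (ξ ⬝ᵥ K.mulVec ξ) := by
    rw [Matrix.smul_mulVec, dotProduct_smul, smul_eq_mul, ← Matrix.mulVec_mulVec, hΘv,
      ← Matrix.mulVec_mulVec, Matrix.dotProduct_mulVec, ← Matrix.mulVec_transpose, hΘs, hΘv]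
  have hvv : (v ⬝ᵥ v) * (a ^ (p - 2) * r ^ ((p - 4) * ε)) ≤ I.card := by
    have h1 : (I.card : ℝ) = ∑ i, if i ∈ I then (1 : ℝ) else 0 := by simp
    rw [h1, dotProduct, Finset.sum_mul]
    refine Finset.sum_le_sum fun i _ => ?_
    by_cases hi : i ∈ I
    · have := weight_bound ha hrε (hw i hi) hp (hθw i)
      rw [← Real.rpow_mul hx.le, mul_comm ε, div_pow, div_pow, sq_abs, ← div_pow,
        ← div_pow] at this
      simpa [hv, hξ, hi, ← sq] using this
    · simp [hv, hξ, hi]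
  have hP : 0 < a ^ (p - 2) * r ^ ((p - 4) * ε) := by positivity
  obtain ⟨μ, hμ, hle⟩ := exists_eig_le _ hAs
    (M ^ (p - 1) * (S / I.card) * a ^ (p - 2) * r ^ ((p - 4) * ε) * b) v hvne (by
      rw [hquad, hMp1]
      have e : M ^ (p - 2) * M * (S / I.card) * a ^ (p - 2) * r ^ ((p - 4) * ε) * b * (v ⬝ᵥ v)
        = M ^ (p - 2) * ((M * S * b) *
          ((v ⬝ᵥ v) * (a ^ (p - 2) * r ^ ((p - 4) * ε)) / I.card)) := by ring
      rw [e]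
      refine mul_le_mul_of_nonneg_left (hKb.trans ?_) hMp.le
      have h1 := (div_le_one hn).2 hvv
      have h2 : 0 ≤ M * S := by positivity
      have h3 : M * S * b ≤ 0 := by nlinarith
      nlinarith)
  refine ⟨μ, hμ, hle.trans ?_⟩
  have hM1 : 0 < M ^ (p - 1) := Real.rpow_pos_of_pos (by linarith) _
  refine mul_le_mul_of_nonpos_right ?_ hb.le
  gcongr
end
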